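/- arXiv:1903.04878 — 2 statements merged into one kernel-verified Lean document; each statement's English description precedes it below -/
import Mathlib

section
/- (Renormalization property, Hölder case of the main theorem.) Let T > 0 and let α, β ∈ (0,1) satisfy αβ + β + 3α − 1 > 0. Let f : (0,T) × ℝ³ × ℝ³ → ℝ be measurable and bounded, and suppose there is K ≥ 0 such that for every t ∈ (0,T) the function (x,ξ) ↦ f(t,x,ξ) is α-Hölder on ℝ⁶ with constant K. Let E, B : (0,T) × ℝ³ → ℝ³ be measurable and bounded, and suppose there is L ≥ 0 such that for every t ∈ (0,T) the functions x ↦ E(t,x) and x ↦ B(t,x) are β-Hölder on ℝ³ with constant L. Assume (f,E,B) is a weak solution of the relativistic Vlasov equation: for every smooth compactly supported Ψ : (0,T) × ℝ³ × ℝ³ → ℝ, ∫_0^T ∫_{ℝ³} ∫_{ℝ³} f · ( ∂_t Ψ + v(ξ)·∇_x Ψ + (E + v(ξ) × B)·∇_ξ Ψ ) dξ dx dt = 0. Then for every continuously differentiable H : ℝ → ℝ, the function H∘f is also a weak solution: for every smooth compactly supported Ψ, ∫_0^T ∫_{ℝ³} ∫_{ℝ³} H(f) · ( ∂_t Ψ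 + v(ξ)·∇_x Ψ + (E + v(ξ) × B)·∇_ξ Ψ ) dξ dx dt = 0. -/
open MeasureTheory Set

noncomputable section

/-- The relativistic velocity `v(ξ) = ξ / √(1+|ξ|²)`. -/
def relV (ξ : EuclideanSpace ℝ (Fin 3)) : EuclideanSpace ℝ (Fin 3) :=
  (Real.sqrt (1 + ‖ξ‖ ^ 2))⁻¹ • ξ

/-- The cross product on `ℝ³`. -/
def cross3 (a b : EuclideanSpace ℝ (Fin 3)) : EuclideanSpace ℝ (Fin 3) :=
  (WithLp.equiv 2 (Fin 3 → ℝ)).symm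
    ![a 1 * b 2 - a 2 * b 1, a 2 * b 0 - a 0 * b 2, a 0 * b 1 - a 1 * b 0]

/-- `weakVlasov T E B g` says that `g` solves the relativistic Vlasov equation with fields
`E, B` in the sense of distributions on `(0,T) × ℝ³ × ℝ³`. -/
def weakVlasov (T : ℝ)
    (E B : ℝ → EuclideanSpace ℝ (Fin 3) → EuclideanSpace ℝ (Fin 3))
    (g : ℝ → EuclideanSpace ℝ (Fin 3) → EuclideanSpace ℝ (Fin 3) → ℝ) : Prop :=
  ∀ Ψ : ℝ → EuclideanSpace ℝ (Fin 3) → EuclideanSpace ℝ (Fin 3) → ℝ,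
    ContDiff ℝ (⊤ : ℕ∞) (fun p : ℝ × EuclideanSpace ℝ (Fin 3) × EuclideanSpace ℝ (Fin 3) =>
      Ψ p.1 p.2.1 p.2.2) →
    HasCompactSupport (fun p : ℝ × EuclideanSpace ℝ (Fin 3) × EuclideanSpace ℝ (Fin 3) =>
      Ψ p.1 p.2.1 p.2.2) →
    tsupport (fun p : ℝ × EuclideanSpace ℝ (Fin 3) × EuclideanSpace ℝ (Fin 3) =>
      Ψ p.1 p.2.1 p.2.2) ⊆ Ioo (0 : ℝ) T ×ˢ univ →
    (∫ t in Ioo (0 : ℝ) T, ∫ x : EuclideanSpace ℝ (Fin 3), ∫ ξ : EuclideanSpace ℝ (Fin 3),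
      g t x ξ * (deriv (fun s => Ψ s x ξ) t
        + fderiv ℝ (fun y => Ψ t y ξ) x (relV ξ)
        + fderiv ℝ (fun η => Ψ t x η) ξ (E t x + cross3 (relV ξ) (B t x)))) = 0

/-- Euclidean three-space. -/
abbrev E3 := EuclideanSpace ℝ (Fin 3)

theorem integrable_of_bounded_of_support {X : Type*} [NormedAddCommGroup X] [ProperSpace X]
    [MeasurableSpace X] {μ : Measure X} [IsFiniteMeasureOnCompacts μ] {g : X → ℝ}
    (hm : Measurable g) {C R : ℝ} (hb : ∀ x, |g x| ≤ C) (hs : ∀ x, R < ‖x‖ → g x = 0) :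
    Integrable g μ := by
  have h : IntegrableOn g (Metric.closedBall 0 R) μ :=
    Measure.integrableOn_of_bounded (isCompact_closedBall 0 R).measure_lt_top.ne
      hm.aestronglyMeasurable (M := C) (Filter.Eventually.of_forall hb)
  refine h.integrable_of_forall_notMem_eq_zero fun x hx => hs x ?_
  simpa using hx

@[fun_prop]
theorem measurable_fderiv_apply_comp {Y F : Type*} [MeasurableSpace Y] [NormedAddCommGroup F]
    [NormedSpace ℝ F] [MeasurableSpace F] [BorelSpace F] [SecondCountableTopology F]
    [SecondCountableTopology (F →L[ℝ] ℝ)] {L : Y → F →L[ℝ] ℝ} {V : Y → F}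
    (hL : Measurable L) (hV : Measurable V) : Measurable fun y => L y (V y) :=
  isBoundedBilinearMap_apply.continuous.measurable.comp (hL.prodMk hV)

theorem eq_zero_of_lt_norm_of_tsupport {X F : Type*} [NormedAddCommGroup X] [Zero F]
    [TopologicalSpace F] {k : X → F} {r : ℝ} (h : tsupport k ⊆ Metric.closedBall 0 r) {z : X}
    (hz : r < ‖z‖) : k z = 0 := by
  by_contra hk
  have := h (subset_tsupport k hk)
  simp at this
  linarith

theorem tsupport_subset_closedBall {X F : Type*} [NormedAddCommGroup X] [Zero F]
    {k : X → F} {r : ℝ} (h : ∀ z, r < ‖z‖ → k z = 0) : tsupport k ⊆ Metric.closedBall 0 r := by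
  refine closure_minimal (fun z hz => ?_) Metric.isClosed_closedBall
  by_contra hk
  exact hz (h z (by simpa using hk))

theorem fderiv_eq_zero_of_lt_norm {X : Type*} [NormedAddCommGroup X] [NormedSpace ℝ X]
    {k : X → ℝ} {r : ℝ} (h : ∀ z, r < ‖z‖ → k z = 0) {z : X} (hz : r < ‖z‖) :
    fderiv ℝ k z = 0 :=
  eq_zero_of_lt_norm_of_tsupport
    ((tsupport_fderiv_subset ℝ).trans (tsupport_subset_closedBall h)) hz

theorem exists_bound_of_lt_norm {X F : Type*} [NormedAddCommGroup X] [ProperSpace X]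
    [NormedAddCommGroup F] {k : X → F} (hk : Continuous k) {r : ℝ}
    (h : ∀ z, r < ‖z‖ → k z = 0) : ∃ C, 0 ≤ C ∧ ∀ z, ‖k z‖ ≤ C := by
  have hc : HasCompactSupport k :=
    (isCompact_closedBall 0 r).of_isClosed_subset (isClosed_tsupport k)
      (tsupport_subset_closedBall h)
  obtain ⟨C, hC⟩ := hc.exists_bound_of_continuous hk
  exact ⟨C, (norm_nonneg _).trans (hC 0), hC⟩

/-- A smooth even mollification kernel on `ℝ³` of unit mass, supported in the ball of radius `r`,
whose gradient has mass at most `A / r`. -/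
structure IsKernel (A r : ℝ) (k : E3 → ℝ) : Prop where
  smooth : ContDiff ℝ (⊤ : ℕ∞) k
  even : ∀ z, k (-z) = k z
  nonneg : ∀ z, 0 ≤ k z
  integral_eq : ∫ z, k z = 1
  supp : ∀ z, r < ‖z‖ → k z = 0
  integral_fderiv_le : ∫ z, ‖fderiv ℝ k z‖ ≤ A / r

theorem exists_isKernel : ∃ A, 0 ≤ A ∧ ∀ r, 0 < r → ∃ k, IsKernel A r k := by
  let φ : ContDiffBump (0 : E3) := ⟨1 / 2, 1, by norm_num, by norm_num⟩
  let ρ : E3 → ℝ := φ.normed volume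
  have hρs : ∀ z, 1 < ‖z‖ → ρ z = 0 := fun z hz =>
    eq_zero_of_lt_norm_of_tsupport (φ.tsupport_normed_eq (μ := volume)).le hz
  refine ⟨∫ z, ‖fderiv ℝ ρ z‖, integral_nonneg fun _ => norm_nonneg _, fun r hr => ?_⟩
  have hρd : ContDiff ℝ (⊤ : ℕ∞) ρ := φ.contDiff_normed
  have hfd : ∀ z, fderiv ℝ (fun z => (r ^ 3)⁻¹ * ρ (r⁻¹ • z)) z
      = ((r ^ 3)⁻¹ * r⁻¹) • fderiv ℝ ρ (r⁻¹ • z) := fun z => by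
    rw [fderiv_const_mul, fderiv_comp_smul, smul_smul]
    exact (hρd.differentiable (by simp)).differentiableAt.comp z (by fun_prop)
  refine ⟨fun z => (r ^ 3)⁻¹ * ρ (r⁻¹ • z), ⟨by fun_prop, fun z => ?_, fun z => ?_, ?_,
    fun z hz => ?_, ?_⟩⟩
  · simp only [ρ, smul_neg, φ.normed_neg]
  · exact mul_nonneg (by positivity) (φ.nonneg_normed _)
  · rw [integral_const_mul, Measure.integral_comp_inv_smul, φ.integral_normed]
    simp [abs_of_pos hr, hr.ne']
  · rw [hρs, mul_zero]
    rw [norm_smul, norm_inv, Real.norm_of_nonneg hr.le, ← div_eq_inv_mul, one_lt_div hr]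
    exact hz
  · simp_rw [hfd, norm_smul]
    rw [integral_const_mul, Measure.integral_comp_inv_smul volume (fun z => ‖fderiv ℝ ρ z‖)]
    apply le_of_eq
    simp [abs_of_pos hr]
    field_simp

namespace IsKernel

variable {A r : ℝ} {k : E3 → ℝ}

theorem fderiv_supp (hk : IsKernel A r k) {z : E3} (hz : r < ‖z‖) : fderiv ℝ k z = 0 :=
  fderiv_eq_zero_of_lt_norm hk.supp hz

theorem continuous_fderiv (hk : IsKernel A r k) : Continuous (fderiv ℝ k) :=
  hk.smooth.continuous_fderiv (by simp)

theorem hasCompactSupport (hk : IsKernel A r k) : HasCompactSupport k :=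
  (isCompact_closedBall 0 r).of_isClosed_subset (isClosed_tsupport k)
    (tsupport_subset_closedBall hk.supp)

theorem fderiv_neg (hk : IsKernel A r k) (z : E3) : fderiv ℝ k (-z) = -fderiv ℝ k z := by
  have h : k = fun z => k ((-1 : ℝ) • z) := funext fun z => by simp [hk.even z]
  conv_rhs => rw [h]
  rw [fderiv_comp_smul]
  simp

theorem integrable_norm_fderiv (hk : IsKernel A r k) :
    Integrable (fun z => ‖fderiv ℝ k z‖) :=
  hk.continuous_fderiv.norm.integrable_of_hasCompactSupport (hk.hasCompactSupport.fderiv ℝ).norm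

end IsKernel

theorem one_le_sqrt_one_add_norm_sq (a : E3) : 1 ≤ Real.sqrt (1 + ‖a‖ ^ 2) :=
  Real.one_le_sqrt.2 (by nlinarith [sq_nonneg ‖a‖])

theorem norm_le_sqrt_one_add_norm_sq (a : E3) : ‖a‖ ≤ Real.sqrt (1 + ‖a‖ ^ 2) :=
  Real.le_sqrt_of_sq_le (by linarith)

theorem norm_relV_le (a : E3) : ‖relV a‖ ≤ 1 := by
  have h1 := one_le_sqrt_one_add_norm_sq a
  rw [relV, norm_smul, norm_inv, Real.norm_of_nonneg (Real.sqrt_nonneg _),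
    inv_mul_le_one₀ (by linarith)]
  exact norm_le_sqrt_one_add_norm_sq a

theorem norm_relV_sub_le (a b : E3) : ‖relV a - relV b‖ ≤ 2 * ‖a - b‖ := by
  set p := Real.sqrt (1 + ‖a‖ ^ 2) with hp
  set q := Real.sqrt (1 + ‖b‖ ^ 2) with hq
  have hp1 : 1 ≤ p := one_le_sqrt_one_add_norm_sq a
  have hq1 : 1 ≤ q := one_le_sqrt_one_add_norm_sq b
  have hpa : ‖a‖ ≤ p := norm_le_sqrt_one_add_norm_sq a
  have hqb : ‖b‖ ≤ q := norm_le_sqrt_one_add_norm_sq b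
  have hp2 : p ^ 2 = 1 + ‖a‖ ^ 2 := Real.sq_sqrt (by positivity)
  have hq2 : q ^ 2 = 1 + ‖b‖ ^ 2 := Real.sq_sqrt (by positivity)
  have hpq : |q - p| ≤ ‖a - b‖ := by
    have h1 : (q - p) * (q + p) = (‖b‖ - ‖a‖) * (‖b‖ + ‖a‖) := by linarith
    have h2 : |q - p| * (q + p) = |‖b‖ - ‖a‖| * (‖b‖ + ‖a‖) := by
      rw [← abs_of_nonneg (show 0 ≤ q + p by linarith), ← abs_mul, h1, abs_mul,
        abs_of_nonneg (show 0 ≤ ‖b‖ + ‖a‖ by positivity)]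
    have h3 : |‖b‖ - ‖a‖| ≤ ‖a - b‖ := by
      rw [norm_sub_rev]; exact abs_norm_sub_norm_le b a
    have h4 : |q - p| * (q + p) ≤ ‖a - b‖ * (q + p) := by
      rw [h2]; exact mul_le_mul h3 (by linarith) (by positivity) (by positivity)
    exact le_of_mul_le_mul_right h4 (by linarith)
  have hdec : relV a - relV b = p⁻¹ • (a - b) + (p⁻¹ * q⁻¹ * (q - p)) • b := by
    have : p⁻¹ * q⁻¹ * (q - p) = p⁻¹ - q⁻¹ := by field_simp
    rw [this, relV, relV, smul_sub, sub_smul]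
    abel
  have hp' : p⁻¹ ≤ 1 := inv_le_one_of_one_le₀ hp1
  calc ‖relV a - relV b‖ ≤ p⁻¹ * ‖a - b‖ + p⁻¹ * q⁻¹ * |q - p| * ‖b‖ := by
        rw [hdec]
        refine (norm_add_le _ _).trans_eq ?_
        rw [norm_smul, norm_smul, Real.norm_eq_abs, Real.norm_eq_abs, abs_mul, abs_mul, abs_inv,
          abs_inv, abs_of_pos (show 0 < p by linarith), abs_of_pos (show 0 < q by linarith)]
    _ = p⁻¹ * ‖a - b‖ + p⁻¹ * |q - p| * (q⁻¹ * ‖b‖) := by ring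
    _ ≤ 1 * ‖a - b‖ + 1 * ‖a - b‖ * 1 := by
        gcongr
        exact (inv_mul_le_one₀ (by linarith)).2 hqb
    _ = 2 * ‖a - b‖ := by ring

@[fun_prop]
theorem continuous_relV : Continuous relV := by
  unfold relV
  refine Continuous.smul (Continuous.inv₀
    (f := fun a : E3 => Real.sqrt (1 + ‖a‖ ^ 2)) (by fun_prop) fun a => ?_) continuous_id
  linarith [one_le_sqrt_one_add_norm_sq a]

theorem cross3_apply_zero (a b : E3) : cross3 a b 0 = a 1 * b 2 - a 2 * b 1 := rfl

theorem cross3_apply_one (a b : E3) : cross3 a b 1 = a 2 * b 0 - a 0 * b 2 := rfl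

theorem cross3_apply_two (a b : E3) : cross3 a b 2 = a 0 * b 1 - a 1 * b 0 := rfl

theorem E3.ext {a b : E3} (h0 : a 0 = b 0) (h1 : a 1 = b 1) (h2 : a 2 = b 2) : a = b := by
  ext i
  fin_cases i <;> assumption

theorem cross3_sub_left (a b c : E3) : cross3 (a - b) c = cross3 a c - cross3 b c := by
  refine E3.ext ?_ ?_ ?_ <;>
  simp only [cross3_apply_zero, cross3_apply_one, cross3_apply_two, PiLp.sub_apply] <;> ring

theorem cross3_sub_right (a b c : E3) : cross3 a (b - c) = cross3 a b - cross3 a c := by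
  refine E3.ext ?_ ?_ ?_ <;>
  simp only [cross3_apply_zero, cross3_apply_one, cross3_apply_two, PiLp.sub_apply] <;> ring

theorem norm_cross3_le (a b : E3) : ‖cross3 a b‖ ≤ ‖a‖ * ‖b‖ := by
  refine abs_le_of_sq_le_sq' ?_ (by positivity) |>.2
  rw [mul_pow, EuclideanSpace.real_norm_sq_eq, EuclideanSpace.real_norm_sq_eq,
    EuclideanSpace.real_norm_sq_eq]
  simp only [Fin.sum_univ_three, cross3_apply_zero, cross3_apply_one, cross3_apply_two]
  nlinarith [sq_nonneg (a 0 * b 0 + a 1 * b 1 + a 2 * b 2)]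

@[fun_prop]
theorem continuous_cross3 : Continuous fun p : E3 × E3 => cross3 p.1 p.2 := by
  unfold cross3
  refine (PiLp.continuous_toLp 2 _).comp (continuous_pi fun i => ?_)
  fin_cases i <;> simp <;> fun_prop

@[fun_prop]
theorem Measurable.cross3 {Y : Type*} [MeasurableSpace Y] {a b : Y → E3} (ha : Measurable a)
    (hb : Measurable b) : Measurable fun y => cross3 (a y) (b y) :=
  continuous_cross3.measurable.comp (ha.prodMk hb)

@[fun_prop]
theorem Measurable.relV {Y : Type*} [MeasurableSpace Y] {a : Y → E3} (ha : Measurable a) :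
    Measurable fun y => relV (a y) :=
  continuous_relV.measurable.comp ha

theorem hasFDerivAt_relV_apply (j : Fin 3) (ξ : E3) :
    HasFDerivAt (fun η => relV η j)
      ((Real.sqrt (1 + ‖ξ‖ ^ 2))⁻¹ • (EuclideanSpace.proj j : E3 →L[ℝ] ℝ)
        + (ξ j * (-(Real.sqrt (1 + ‖ξ‖ ^ 2) ^ 2)⁻¹ * (1 / (2 * Real.sqrt (1 + ‖ξ‖ ^ 2)) * 2)))
          • innerSL ℝ ξ) ξ := by
  have h0 : (1 : ℝ) + ‖ξ‖ ^ 2 ≠ 0 := by positivity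
  have h1 := ((hasStrictFDerivAt_norm_sq ξ).hasFDerivAt.const_add 1).sqrt h0
  have h2 := (hasDerivAt_inv (Real.sqrt_ne_zero'.2 (by positivity : (0 : ℝ) < 1 + ‖ξ‖ ^ 2))
    ).comp_hasFDerivAt ξ h1
  have h3 := h2.mul (EuclideanSpace.proj j : E3 →L[ℝ] ℝ).hasFDerivAt
  refine h3.congr_fderiv ?_
  ext w
  simp
  ring

theorem fderiv_relV_symm (i j : Fin 3) (ξ : E3) :
    fderiv ℝ (fun η => relV η j) ξ (EuclideanSpace.single i 1)
      = fderiv ℝ (fun η => relV η i) ξ (EuclideanSpace.single j 1) := by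
  rw [(hasFDerivAt_relV_apply j ξ).fderiv, (hasFDerivAt_relV_apply i ξ).fderiv]
  simp [EuclideanSpace.inner_single_right, eq_comm]
  ring

theorem contDiff_relV : ContDiff ℝ 1 relV := by
  unfold relV
  refine ContDiff.smul (ContDiff.inv (ContDiff.sqrt
    (contDiff_const.add (contDiff_norm_sq ℝ)) fun x => by positivity)
    fun x => ?_) contDiff_id
  linarith [one_le_sqrt_one_add_norm_sq x]

theorem contDiff_relV_apply (j : Fin 3) : ContDiff ℝ 1 fun η => relV η j :=
  (EuclideanSpace.proj j : E3 →L[ℝ] ℝ).contDiff.comp contDiff_relV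

theorem fderiv_apply_eq_sum (φ : E3 → ℝ) (ξ w : E3) :
    fderiv ℝ φ ξ w = ∑ i, w i * fderiv ℝ φ ξ (EuclideanSpace.single i 1) := by
  conv_lhs => rw [← (EuclideanSpace.basisFun (Fin 3) ℝ).sum_repr w]
  simp

section

variable {X : Type*} [NormedAddCommGroup X] [NormedSpace ℝ X] [MeasurableSpace X] [BorelSpace X]
  {μ : Measure X} [μ.IsAddHaarMeasure]

theorem integrable_mul_fderiv {c φ : X → ℝ} (hc : Continuous c) (hφ : ContDiff ℝ 1 φ)
    (hφc : HasCompactSupport φ) (w : X) : Integrable (fun x => c x * fderiv ℝ φ x w) μ := by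
  have h := hφ.continuous_fderiv (by simp)
  exact Continuous.integrable_of_hasCompactSupport (by fun_prop)
    (HasCompactSupport.mul_left (hφc.fderiv_apply ℝ w))

theorem integral_mul_fderiv_eq_neg [FiniteDimensional ℝ X] {c φ : X → ℝ}
    (hc : ContDiff ℝ 1 c) (hφ : ContDiff ℝ 1 φ) (hφc : HasCompactSupport φ) (w : X) :
    ∫ x, c x * fderiv ℝ φ x w ∂μ = -∫ x, fderiv ℝ c x w * φ x ∂μ := by
  have h := hc.continuous_fderiv (by simp)
  have h1 := hc.continuous
  have h2 := hφ.continuous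
  refine integral_mul_fderiv_eq_neg_fderiv_mul_of_integrable ?_
    (integrable_mul_fderiv hc.continuous hφ hφc w) ?_
    (fun x _ => hc.differentiable (by simp) x) (fun x _ => hφ.differentiable (by simp) x)
  · exact Continuous.integrable_of_hasCompactSupport (by fun_prop) hφc.mul_left
  · exact Continuous.integrable_of_hasCompactSupport (by fun_prop) hφc.mul_left

end

theorem integral_relV_mul_fderiv_symm {φ : E3 → ℝ} (hφ : ContDiff ℝ 1 φ)
    (hφc : HasCompactSupport φ) (i j : Fin 3) :
    ∫ ξ, relV ξ j * fderiv ℝ φ ξ (EuclideanSpace.single i 1)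
      = ∫ ξ, relV ξ i * fderiv ℝ φ ξ (EuclideanSpace.single j 1) := by
  rw [integral_mul_fderiv_eq_neg (contDiff_relV_apply j) hφ hφc,
    integral_mul_fderiv_eq_neg (contDiff_relV_apply i) hφ hφc]
  simp_rw [fderiv_relV_symm i j]

/-- The magnetic force `v(ξ) × b` is divergence free in `ξ`. -/
theorem integral_fderiv_cross3_relV {φ : E3 → ℝ} (hφ : ContDiff ℝ 1 φ)
    (hφc : HasCompactSupport φ) (b : E3) :
    ∫ ξ, fderiv ℝ φ ξ (cross3 (relV ξ) b) = 0 := by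
  have hi : ∀ i j, Integrable fun ξ => relV ξ j * fderiv ℝ φ ξ (EuclideanSpace.single i 1) :=
    fun i j => integrable_mul_fderiv (contDiff_relV_apply j).continuous hφ hφc _
  let D : Fin 3 → Fin 3 → E3 → ℝ := fun i j ξ =>
    relV ξ j * fderiv ℝ φ ξ (EuclideanSpace.single i 1)
      - relV ξ i * fderiv ℝ φ ξ (EuclideanSpace.single j 1)
  have hDi : ∀ i j, Integrable (D i j) := fun i j => (hi i j).sub (hi j i)
  have hD : ∀ i j, ∫ ξ, D i j ξ = 0 := fun i j => by
    rw [integral_sub (hi i j) (hi j i), integral_relV_mul_fderiv_symm hφ hφc, sub_self]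
  have h : ∀ ξ, fderiv ℝ φ ξ (cross3 (relV ξ) b)
      = b 0 * D 1 2 ξ + b 1 * D 2 0 ξ + b 2 * D 0 1 ξ := fun ξ => by
    rw [fderiv_apply_eq_sum]
    simp only [Fin.sum_univ_three, cross3_apply_zero, cross3_apply_one, cross3_apply_two, D]
    ring
  have h0 := (hDi 1 2).const_mul (b 0)
  have h1 := (hDi 2 0).const_mul (b 1)
  have h2 := (hDi 0 1).const_mul (b 2)
  simp_rw [h]
  have h01 : Integrable fun ξ => b 0 * D 1 2 ξ + b 1 * D 2 0 ξ := h0.add h1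
  rw [integral_add h01 h2, integral_add h0 h1]
  simp [integral_const_mul, hD]

/-- The phase space-time `ℝ × ℝ³ × ℝ³`. -/
abbrev Phase := ℝ × E3 × E3

instance : (volume : Measure (E3 × E3)).IsAddHaarMeasure :=
  inferInstanceAs ((volume : Measure E3).prod (volume : Measure E3)).IsAddHaarMeasure

instance : (volume : Measure Phase).IsAddHaarMeasure :=
  Measure.prod.instIsAddHaarMeasure (volume : Measure ℝ) (volume : Measure (E3 × E3))

/-- Test functions on `(0,T) × ℝ³ × ℝ³`. -/
structure IsTest (T : ℝ) (Ψ : Phase → ℝ) : Prop where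
  smooth : ContDiff ℝ (⊤ : ℕ∞) Ψ
  compact : HasCompactSupport Ψ
  supp : tsupport Ψ ⊆ Ioo (0 : ℝ) T ×ˢ univ

/-- `g` solves `∂_t g + div (A g) = 0` in the sense of distributions on `(0,T) × ℝ³ × ℝ³`. -/
def WeakSol (T : ℝ) (A : Phase → E3 × E3) (g : Phase → ℝ) : Prop :=
  ∀ Ψ, IsTest T Ψ → ∫ p, g p * fderiv ℝ Ψ p (1, A p) = 0

/-- Measurable and bounded. -/
structure MeasBdd {X F : Type*} [MeasurableSpace X] [MeasurableSpace F] [Norm F] (g : X → F) :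
    Prop where
  measurable : Measurable g
  bounded : ∃ M, ∀ x, ‖g x‖ ≤ M

theorem MeasBdd.exists_nonneg_bound {X F : Type*} [MeasurableSpace X] [MeasurableSpace F]
    [SeminormedAddGroup F] {g : X → F} (hg : MeasBdd g) : ∃ M, 0 ≤ M ∧ ∀ x, ‖g x‖ ≤ M := by
  obtain ⟨M, hM⟩ := hg.bounded
  exact ⟨|M|, abs_nonneg _, fun x => (hM x).trans (le_abs_self M)⟩

namespace IsTest

variable {T : ℝ} {Ψ : Phase → ℝ}

theorem continuous_fderiv (h : IsTest T Ψ) : Continuous (fderiv ℝ Ψ) :=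
  h.smooth.continuous_fderiv (by simp)

theorem differentiable (h : IsTest T Ψ) : Differentiable ℝ Ψ :=
  h.smooth.differentiable (by simp)

theorem exists_bound (h : IsTest T Ψ) : ∃ C R, 0 ≤ C ∧ 0 ≤ R ∧ (∀ p, |Ψ p| ≤ C) ∧
    (∀ p, ‖fderiv ℝ Ψ p‖ ≤ C) ∧ (∀ p, R < ‖p‖ → Ψ p = 0) ∧
    (∀ p, R < ‖p‖ → fderiv ℝ Ψ p = 0) := by
  obtain ⟨C₁, h₁⟩ := h.compact.exists_bound_of_continuous h.smooth.continuous
  obtain ⟨C₂, h₂⟩ := (h.compact.fderiv ℝ).exists_bound_of_continuous h.continuous_fderiv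
  obtain ⟨R, hR⟩ := h.compact.isBounded.subset_closedBall 0
  have h0 : ∀ p, |R| < ‖p‖ → Ψ p = 0 := fun p hp =>
    eq_zero_of_lt_norm_of_tsupport hR ((le_abs_self R).trans_lt hp)
  refine ⟨max C₁ C₂, |R|, ((norm_nonneg _).trans (h₁ 0)).trans (le_max_left _ _), abs_nonneg _,
    fun p => (h₁ p).trans (le_max_left _ _), fun p => (h₂ p).trans (le_max_right _ _), h0,
    fun p hp => fderiv_eq_zero_of_lt_norm h0 hp⟩

theorem eq_zero (h : IsTest T Ψ) {p : Phase} (hp : p.1 ∉ Ioo 0 T) : Ψ p = 0 := by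
  by_contra hne
  exact hp (h.supp (subset_tsupport Ψ hne)).1

theorem fderiv_eq_zero (h : IsTest T Ψ) {p : Phase} (hp : p.1 ∉ Ioo 0 T) : fderiv ℝ Ψ p = 0 := by
  by_contra hne
  exact hp (h.supp (support_fderiv_subset ℝ hne)).1

theorem integrable {g : Phase → ℝ} {A : Phase → E3 × E3} (h : IsTest T Ψ) (hg : MeasBdd g)
    (hA : MeasBdd A) : Integrable fun p => g p * fderiv ℝ Ψ p (1, A p) := by
  obtain ⟨C, R, hC, -, -, hb, -, hs⟩ := h.exists_bound
  obtain ⟨M, hM, hgM⟩ := hg.exists_nonneg_bound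
  obtain ⟨N, hN, hAN⟩ := hA.exists_nonneg_bound
  have h1 := h.continuous_fderiv.measurable
  have h2 := hg.measurable
  have h3 := hA.measurable
  refine integrable_of_bounded_of_support (by fun_prop) (C := M * (C * max 1 N)) (R := R)
    (fun p => ?_) fun p hp => by simp [hs p hp]
  rw [abs_mul]
  refine mul_le_mul (hgM p) (((fderiv ℝ Ψ p).le_opNorm (1, A p)).trans ?_) (abs_nonneg _) hM
  refine mul_le_mul (hb p) ?_ (norm_nonneg _) hC
  rw [Prod.norm_def]
  exact max_le_max (by simp) (hAN p)

end IsTest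

/-- The phase-space velocity `(v(ξ), E + v(ξ) × B)` of the Vlasov equation. -/
def vlasovField (E B : ℝ → E3 → E3) (p : Phase) : E3 × E3 :=
  (relV p.2.2, E p.1 p.2.1 + cross3 (relV p.2.2) (B p.1 p.2.1))

theorem measBdd_vlasovField {E B : ℝ → E3 → E3}
    (hE : MeasBdd fun p : ℝ × E3 => E p.1 p.2) (hB : MeasBdd fun p : ℝ × E3 => B p.1 p.2) :
    MeasBdd (vlasovField E B) := by
  obtain ⟨M, hM, hEM⟩ := hE.exists_nonneg_bound
  obtain ⟨N, hN, hBN⟩ := hB.exists_nonneg_bound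
  have hp : Measurable fun p : Phase => (p.1, p.2.1) := by fun_prop
  have hE' : Measurable fun p : Phase => E p.1 p.2.1 := hE.measurable.comp hp
  have hB' : Measurable fun p : Phase => B p.1 p.2.1 := hB.measurable.comp hp
  refine ⟨?_, max 1 (M + N), fun p => ?_⟩
  · have hv : Measurable fun p : Phase => relV p.2.2 := by fun_prop
    exact hv.prodMk (hE'.add (hv.cross3 hB'))
  rw [Prod.norm_def]
  refine max_le_max (norm_relV_le _) ((norm_add_le _ _).trans (add_le_add (hEM (p.1, p.2.1)) ?_))
  refine (norm_cross3_le _ _).trans ?_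
  calc _ ≤ 1 * N := mul_le_mul (norm_relV_le _) (hBN (p.1, p.2.1)) (norm_nonneg _) zero_le_one
    _ = N := one_mul N

theorem fderiv_eq_partial_sum {Φ : Phase → ℝ} (hΦ : Differentiable ℝ Φ) (t : ℝ) (x ξ v F : E3) :
    deriv (fun s => Φ (s, x, ξ)) t + fderiv ℝ (fun y => Φ (t, y, ξ)) x v
      + fderiv ℝ (fun η => Φ (t, x, η)) ξ F = fderiv ℝ Φ (t, x, ξ) (1, v, F) := by
  have h := (hΦ (t, x, ξ)).hasFDerivAt
  have h1 : HasFDerivAt (fun s : ℝ => ((s, x, ξ) : Phase))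
      (ContinuousLinearMap.inl ℝ ℝ (E3 × E3)) t := hasFDerivAt_prodMk_left t (x, ξ)
  have h2 : HasFDerivAt (fun y : E3 => ((t, y, ξ) : Phase))
      ((ContinuousLinearMap.inr ℝ ℝ (E3 × E3)).comp (ContinuousLinearMap.inl ℝ E3 E3)) x :=
    (hasFDerivAt_prodMk_right t (x, ξ)).comp x (hasFDerivAt_prodMk_left x ξ)
  have h3 : HasFDerivAt (fun η : E3 => ((t, x, η) : Phase))
      ((ContinuousLinearMap.inr ℝ ℝ (E3 × E3)).comp (ContinuousLinearMap.inr ℝ E3 E3)) ξ :=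
    (hasFDerivAt_prodMk_right t (x, ξ)).comp ξ (hasFDerivAt_prodMk_right x ξ)
  have e1 : deriv (fun s => Φ (s, x, ξ)) t = fderiv ℝ Φ (t, x, ξ) (1, 0, 0) := by
    exact (h.comp t h1).hasDerivAt.deriv.trans (by simp; rfl)
  have e2 : fderiv ℝ (fun y => Φ (t, y, ξ)) x v = fderiv ℝ Φ (t, x, ξ) (0, v, 0) := by
    exact congrArg (fun L => L v) (h.comp x h2).fderiv
  have e3 : fderiv ℝ (fun η => Φ (t, x, η)) ξ F = fderiv ℝ Φ (t, x, ξ) (0, 0, F) := by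
    exact congrArg (fun L => L F) (h.comp ξ h3).fderiv
  rw [e1, e2, e3, ← map_add, ← map_add]
  simp

theorem weakVlasov_iff {T : ℝ} {E B : ℝ → E3 → E3} {g : ℝ → E3 → E3 → ℝ}
    (hE : MeasBdd fun p : ℝ × E3 => E p.1 p.2) (hB : MeasBdd fun p : ℝ × E3 => B p.1 p.2)
    (hg : MeasBdd fun p : Phase => g p.1 p.2.1 p.2.2) :
    weakVlasov T E B g ↔ WeakSol T (vlasovField E B) fun p => g p.1 p.2.1 p.2.2 := by
  have key : ∀ Φ : Phase → ℝ, IsTest T Φ →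
      (∫ t in Ioo (0 : ℝ) T, ∫ x : E3, ∫ ξ : E3,
        g t x ξ * (deriv (fun s => Φ (s, x, ξ)) t + fderiv ℝ (fun y => Φ (t, y, ξ)) x (relV ξ)
          + fderiv ℝ (fun η => Φ (t, x, η)) ξ (E t x + cross3 (relV ξ) (B t x))))
      = ∫ p : Phase, g p.1 p.2.1 p.2.2 * fderiv ℝ Φ p (1, vlasovField E B p) := by
    intro Φ hΦ
    have hi := hΦ.integrable hg (measBdd_vlasovField hE hB)
    simp_rw [fderiv_eq_partial_sum hΦ.differentiable]
    rw [Measure.volume_eq_prod, integral_prod _ hi,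
      setIntegral_eq_integral_of_forall_compl_eq_zero fun t ht => ?_]
    · refine integral_congr_ae ?_
      filter_upwards [hi.prod_right_ae] with t ht
      rw [Measure.volume_eq_prod, integral_prod _ ht]
      rfl
    · simp [hΦ.fderiv_eq_zero (p := (t, _, _)) ht]
  constructor
  · intro h Φ hΦ
    rw [← key Φ hΦ]
    exact h (fun t x ξ => Φ (t, x, ξ)) hΦ.smooth hΦ.compact hΦ.supp
  · intro h Ψ h1 h2 h3
    have hΦ : IsTest T (fun p : Phase => Ψ p.1 p.2.1 p.2.2) := ⟨h1, h2, h3⟩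
    exact (key _ hΦ).trans (h _ hΦ)

theorem integrable_of_bounded_of_sub_support {X : Type*} [NormedAddCommGroup X] [ProperSpace X]
    [MeasurableSpace X] {μ : Measure (X × X)} [IsFiniteMeasureOnCompacts μ]
    {g : X × X → ℝ} (hm : Measurable g) {C R r : ℝ} (hb : ∀ z, |g z| ≤ C)
    (hs : ∀ z, R < ‖z.2‖ → g z = 0) (hs' : ∀ z, r < ‖z.1 - z.2‖ → g z = 0) :
    Integrable g μ := by
  refine integrable_of_bounded_of_support hm (R := max R (R + r)) hb fun z hz => ?_
  rw [Prod.norm_def, lt_max_iff, max_lt_iff, max_lt_iff] at hz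
  rcases lt_or_ge R ‖z.2‖ with h | h
  · exact hs z h
  refine hs' z ?_
  rcases hz with h3 | h3
  · linarith [norm_sub_norm_le z.1 z.2, h3.2]
  · exact absurd h3.1 (not_lt.2 h)

theorem IsTest.comp_sub_left {T : ℝ} {Ψ κ : Phase → ℝ} (hΨ : IsTest T Ψ)
    (hκ : ContDiff ℝ (⊤ : ℕ∞) κ) (p : Phase) : IsTest T fun q => Ψ q * κ (p - q) where
  smooth := hΨ.smooth.mul (hκ.comp (contDiff_const.sub contDiff_id))
  compact := hΨ.compact.mul_right
  supp := (tsupport_mul_subset_left).trans hΨ.supp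

theorem isTest_comp_sub_right {T : ℝ} {κ : Phase → ℝ}
    (hκ : ContDiff ℝ (⊤ : ℕ∞) κ) (hκc : HasCompactSupport κ) {q : Phase}
    (hq : ∀ p ∈ tsupport κ, q + p ∈ Ioo (0 : ℝ) T ×ˢ univ) : IsTest T fun p => κ (p - q) where
  smooth := hκ.comp (contDiff_id.sub contDiff_const)
  compact := hκc.comp_homeomorph (Homeomorph.subRight q)
  supp := fun p hp => by
    have h1 : p - q ∈ tsupport κ :=
      tsupport_comp_subset_preimage κ (f := fun p : Phase => p - q) (by fun_prop) hp
    simpa using hq _ h1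

theorem WeakSol.integral_doubling {T : ℝ} {A : Phase → E3 × E3} {u Ψ κ : Phase → ℝ}
    (hw : WeakSol T A u) (hu : MeasBdd u) (hA : MeasBdd A) (hΨ : IsTest T Ψ)
    (hκ : ContDiff ℝ (⊤ : ℕ∞) κ) (hκc : HasCompactSupport κ)
    (hs : ∀ q, Ψ q ≠ 0 → ∀ p ∈ tsupport κ, q + p ∈ Ioo (0 : ℝ) T ×ˢ univ) :
    ∫ z : Phase × Phase, u z.1 * u z.2 * (fderiv ℝ Ψ z.2 (1, A z.2) * κ (z.1 - z.2)
      + Ψ z.2 * fderiv ℝ κ (z.1 - z.2) (0, A z.1 - A z.2)) = 0 := by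
  obtain ⟨C, R, hC, hR, hΨb, hΨb', hΨs, hΨs'⟩ := hΨ.exists_bound
  obtain ⟨M, hM, huM⟩ := hu.exists_nonneg_bound
  obtain ⟨N, hN, hAN⟩ := hA.exists_nonneg_bound
  obtain ⟨c, hc⟩ := hκc.isBounded.subset_closedBall 0
  have hκs : ∀ p, c < ‖p‖ → κ p = 0 := fun p hp => eq_zero_of_lt_norm_of_tsupport hc hp
  have hκs' : ∀ p, c < ‖p‖ → fderiv ℝ κ p = 0 := fun p hp => fderiv_eq_zero_of_lt_norm hκs hp
  obtain ⟨D, hD, hκb⟩ := exists_bound_of_lt_norm hκ.continuous hκs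
  obtain ⟨D', hD', hκb'⟩ := exists_bound_of_lt_norm (hκ.continuous_fderiv (by simp)) hκs'
  have hmu := hu.measurable
  have hmA := hA.measurable
  have hmΨ := hΨ.smooth.continuous.measurable
  have hmΨ' := hΨ.continuous_fderiv.measurable
  have hmκ := hκ.continuous.measurable
  have hmκ' := (hκ.continuous_fderiv (by simp)).measurable
  have hdκ : Differentiable ℝ κ := hκ.differentiable (by simp)
  have hA1 : ∀ p, ‖((1 : ℝ), A p)‖ ≤ max 1 N := fun p => by
    rw [Prod.norm_def]
    exact max_le_max (by simp) (hAN p)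
  have hκA : ∀ q p, |fderiv ℝ κ q (1, A p)| ≤ D' * max 1 N := fun q p =>
    ((fderiv ℝ κ q).le_opNorm _).trans (mul_le_mul (hκb' q) (hA1 p) (norm_nonneg _) hD')
  have hΨA : ∀ q p, |fderiv ℝ Ψ q (1, A p)| ≤ C * max 1 N := fun q p =>
    ((fderiv ℝ Ψ q).le_opNorm _).trans (mul_le_mul (hΨb' q) (hA1 p) (norm_nonneg _) hC)
  have i1 : Integrable (fun z : Phase × Phase =>
      u z.2 * Ψ z.2 * (u z.1 * fderiv ℝ κ (z.1 - z.2) (1, A z.1))) := by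
    refine integrable_of_bounded_of_sub_support (by fun_prop)
      (C := M * C * (M * (D' * max 1 N))) (R := R) (r := c) (fun z => ?_)
      (fun z hz => by simp [hΨs _ hz]) (fun z hz => by simp [hκs' _ hz])
    simp only [abs_mul]
    have := hκA (z.1 - z.2) z.1
    have := hΨb z.2
    have h1 : |u z.1| ≤ M := huM z.1
    have h2 : |u z.2| ≤ M := huM z.2
    gcongr
  have i2 : Integrable (fun z : Phase × Phase =>
      u z.1 * (u z.2 * (fderiv ℝ Ψ z.2 (1, A z.2) * κ (z.1 - z.2)
        - Ψ z.2 * fderiv ℝ κ (z.1 - z.2) (1, A z.2)))) := by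
    refine integrable_of_bounded_of_sub_support (by fun_prop)
      (C := M * (M * (C * max 1 N * D + C * (D' * max 1 N)))) (R := R) (r := c) (fun z => ?_)
      (fun z hz => by simp [hΨs _ hz, hΨs' _ hz])
      (fun z hz => by simp [hκs _ hz, hκs' _ hz])
    simp only [abs_mul]
    have h3 := hκA (z.1 - z.2) z.2
    have h4 := hΨA z.2 z.2
    have h5 := hΨb z.2
    have h6 : |κ (z.1 - z.2)| ≤ D := hκb (z.1 - z.2)
    have h1 : |u z.1| ≤ M := huM z.1
    have h2 : |u z.2| ≤ M := huM z.2
    have h7 : |fderiv ℝ Ψ z.2 (1, A z.2) * κ (z.1 - z.2)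
        - Ψ z.2 * fderiv ℝ κ (z.1 - z.2) (1, A z.2)| ≤ C * max 1 N * D + C * (D' * max 1 N) := by
      refine (abs_sub _ _).trans ?_
      simp only [abs_mul]
      gcongr
    gcongr
  have e1 : ∫ z : Phase × Phase,
      u z.2 * Ψ z.2 * (u z.1 * fderiv ℝ κ (z.1 - z.2) (1, A z.1)) = 0 := by
    rw [Measure.volume_eq_prod, integral_prod_symm _ i1]
    refine integral_eq_zero_of_ae (Filter.Eventually.of_forall fun q => ?_)
    simp only [integral_const_mul, Pi.zero_apply]
    by_cases hq : Ψ q = 0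
    · simp [hq]
    · have := hw _ (isTest_comp_sub_right hκ hκc (hs q hq))
      simp only [fderiv_comp_sub] at this
      rw [this, mul_zero]
  have e2 : ∫ z : Phase × Phase,
      u z.1 * (u z.2 * (fderiv ℝ Ψ z.2 (1, A z.2) * κ (z.1 - z.2)
        - Ψ z.2 * fderiv ℝ κ (z.1 - z.2) (1, A z.2))) = 0 := by
    rw [Measure.volume_eq_prod, integral_prod _ i2]
    refine integral_eq_zero_of_ae (Filter.Eventually.of_forall fun p => ?_)
    simp only [integral_const_mul, Pi.zero_apply]
    have := hw _ (hΨ.comp_sub_left hκ p)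
    have hd : ∀ q, fderiv ℝ (fun q => Ψ q * κ (p - q)) q (1, A q)
        = fderiv ℝ Ψ q (1, A q) * κ (p - q) - Ψ q * fderiv ℝ κ (p - q) (1, A q) := fun q => by
      have h1 : HasFDerivAt (fun q => κ (p - q)) (-fderiv ℝ κ (p - q)) q := by
        have := (hdκ (p - q)).hasFDerivAt.comp q ((hasFDerivAt_id q).const_sub p)
        rwa [ContinuousLinearMap.comp_neg, ContinuousLinearMap.comp_id] at this
      rw [((hΨ.differentiable q).hasFDerivAt.fun_mul h1).fderiv]
      simp
      ring
    simp only [hd] at this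
    rw [this, mul_zero]
  have e3 := integral_add i1 i2
  rw [e1, e2, add_zero] at e3
  refine Eq.trans ?_ e3
  refine integral_congr_ae (Filter.Eventually.of_forall fun z => ?_)
  have h : fderiv ℝ κ (z.1 - z.2) (0, A z.1 - A z.2) = fderiv ℝ κ (z.1 - z.2) (1, A z.1)
      - fderiv ℝ κ (z.1 - z.2) (1, A z.2) := by
    rw [← map_sub]; simp
  simp only [h]
  ring

open Filter Topology in
theorem tendsto_integral_bump_mul {φ : ℕ → ContDiffBump (0 : ℝ)}
    (hφ : Tendsto (fun n => (φ n).rOut) atTop (𝓝 0)) (hφ' : ∀ n, (φ n).rOut ≤ 2 * (φ n).rIn)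
    {a b : ℝ → ℝ} (ha : Measurable a) (hb : Measurable b) {C R : ℝ} (haC : ∀ s, |a s| ≤ C)
    (hbC : ∀ s, |b s| ≤ C) (hbR : ∀ s, R < ‖s‖ → b s = 0) :
    (∀ n, |∫ z : ℝ × ℝ, (φ n).normed volume (z.1 - z.2) * (a z.1 * b z.2)| ≤ C * ∫ t, |b t|) ∧
    Tendsto (fun n => ∫ z : ℝ × ℝ, (φ n).normed volume (z.1 - z.2) * (a z.1 * b z.2)) atTop
      (𝓝 (∫ t, a t * b t)) := by
  have hζ : ∀ n, Continuous ((φ n).normed volume) := fun n => (φ n).continuous_normed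
  have hζm : ∀ n, Measurable ((φ n).normed volume) := fun n => (hζ n).measurable
  have hζs : ∀ n z, (φ n).rOut < ‖z‖ → (φ n).normed volume z = 0 := fun n z hz =>
    eq_zero_of_lt_norm_of_tsupport ((φ n).tsupport_normed_eq (μ := volume)).le hz
  have hconv : ∀ n t, convolution ((φ n).normed volume) a (ContinuousLinearMap.lsmul ℝ ℝ) volume t
      = ∫ s, (φ n).normed volume (s - t) * a s := fun n t => by
    rw [convolution_eq_swap]
    refine integral_congr_ae (Eventually.of_forall fun s => ?_)
    simp only [ContinuousLinearMap.lsmul_apply, smul_eq_mul]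
    rw [← (φ n).normed_neg, neg_sub]
  have hint : ∀ n t, Integrable fun s => (φ n).normed volume (s - t) := fun n t =>
    (φ n).integrable_normed.comp_sub_right t
  have hle : ∀ n t, |∫ s, (φ n).normed volume (s - t) * a s| ≤ C := fun n t => by
    have h1 : ∫ s, (φ n).normed volume (s - t) * C = C := by
      rw [integral_mul_const, integral_sub_right_eq_self (fun s => (φ n).normed volume s) t,
        (φ n).integral_normed, one_mul]
    refine le_of_le_of_eq ?_ h1
    rw [← Real.norm_eq_abs]
    refine norm_integral_le_of_norm_le ((hint n t).mul_const C) (Eventually.of_forall fun s => ?_)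
    rw [norm_mul, Real.norm_of_nonneg ((φ n).nonneg_normed _)]
    exact mul_le_mul_of_nonneg_left (haC s) ((φ n).nonneg_normed _)
  have hae : ∀ᵐ t, Tendsto (fun n => ∫ s, (φ n).normed volume (s - t) * a s) atTop
      (𝓝 (a t)) := by
    have hloc : LocallyIntegrable a := by
      refine (locallyIntegrable_const C).mono ha.aestronglyMeasurable
        (Eventually.of_forall fun s => ?_)
      exact (haC s).trans (le_abs_self C)
    filter_upwards [ContDiffBump.ae_convolution_tendsto_right_of_locallyIntegrable
      hφ (Eventually.of_forall hφ') hloc] with t ht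
    simpa only [hconv] using ht
  have heq : ∀ n, ∫ z : ℝ × ℝ, (φ n).normed volume (z.1 - z.2) * (a z.1 * b z.2)
      = ∫ t, (∫ s, (φ n).normed volume (s - t) * a s) * b t := fun n => by
    obtain ⟨D, hD, hζD⟩ := exists_bound_of_lt_norm (hζ n) (hζs n)
    have := hζm n
    have hi : Integrable fun z : ℝ × ℝ =>
        (φ n).normed volume (z.1 - z.2) * (a z.1 * b z.2) := by
      refine integrable_of_bounded_of_sub_support (by fun_prop) (C := D * (C * C)) (R := R)
        (r := (φ n).rOut) (fun z => ?_) (fun z hz => by simp [hbR _ hz])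
        (fun z hz => by simp [hζs n _ hz])
      have h1 := hζD (z.1 - z.2)
      have h2 := haC z.1
      have h3 := hbC z.2
      rw [Real.norm_eq_abs] at h1
      simp only [abs_mul]
      have : 0 ≤ C := (abs_nonneg _).trans h2
      gcongr
    rw [Measure.volume_eq_prod, integral_prod_symm _ hi]
    simp only [← mul_assoc, integral_mul_const]
  simp only [heq]
  have hbi : Integrable b := integrable_of_bounded_of_support hb hbC hbR
  have hdom : ∀ n t, ‖(∫ s, (φ n).normed volume (s - t) * a s) * b t‖ ≤ C * |b t| := fun n t => by
    rw [norm_mul]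
    exact mul_le_mul_of_nonneg_right (hle n t) (norm_nonneg _)
  refine ⟨fun n => ?_, tendsto_integral_of_dominated_convergence (fun t => C * |b t|) (fun n => ?_)
    (hbi.norm.const_mul C) (fun n => Eventually.of_forall (hdom n)) ?_⟩
  · rw [← integral_const_mul]
    exact norm_integral_le_of_norm_le (hbi.norm.const_mul C) (Eventually.of_forall (hdom n))
  · have h1 : StronglyMeasurable fun t => ∫ s, (φ n).normed volume (s - t) * a s := by
      have := hζm n
      refine StronglyMeasurable.integral_prod_right (f := fun t s =>
        (φ n).normed volume (s - t) * a s) (Measurable.stronglyMeasurable ?_)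
      fun_prop
    exact (h1.mul hb.stronglyMeasurable).aestronglyMeasurable
  · filter_upwards [hae] with t ht
    exact ht.mul_const _

open Filter Topology in
theorem tendsto_integral_bump_mul_prod {Z : Type*} [NormedAddCommGroup Z] [ProperSpace Z]
    [MeasureSpace Z] [SFinite (volume : Measure Z)]
    [IsFiniteMeasureOnCompacts (volume : Measure Z)]
    {φ : ℕ → ContDiffBump (0 : ℝ)}
    (hφ : Tendsto (fun n => (φ n).rOut) atTop (𝓝 0)) (hφ' : ∀ n, (φ n).rOut ≤ 2 * (φ n).rIn)
    {a b : ℝ × Z → ℝ} (ha : Measurable a) (hb : Measurable b) {C R : ℝ} (haC : ∀ p, |a p| ≤ C)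
    (hbC : ∀ p, |b p| ≤ C) (hbR : ∀ p, R < ‖p‖ → b p = 0) :
    (∀ n, Integrable fun z : (ℝ × ℝ) × Z => (φ n).normed volume (z.1.1 - z.1.2) *
      (a (z.1.1, z.2) * b (z.1.2, z.2))) ∧ Integrable (fun p => a p * b p) ∧
    Tendsto (fun n => ∫ z : (ℝ × ℝ) × Z, (φ n).normed volume (z.1.1 - z.1.2) *
      (a (z.1.1, z.2) * b (z.1.2, z.2))) atTop (𝓝 (∫ p, a p * b p)) := by
  have hi : ∀ n, Integrable fun z : (ℝ × ℝ) × Z => (φ n).normed volume (z.1.1 - z.1.2) *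
      (a (z.1.1, z.2) * b (z.1.2, z.2)) := fun n => by
    have hζ := (φ n).continuous_normed (μ := (volume : Measure ℝ))
    have hζs : ∀ z, (φ n).rOut < ‖z‖ → (φ n).normed volume z = 0 := fun z hz =>
      eq_zero_of_lt_norm_of_tsupport ((φ n).tsupport_normed_eq (μ := volume)).le hz
    obtain ⟨D, hD, hζD⟩ := exists_bound_of_lt_norm hζ hζs
    have hζm := hζ.measurable
    refine integrable_of_bounded_of_support (by fun_prop) (C := D * (C * C))
      (R := R + (φ n).rOut) (fun z => ?_) (fun z hz => ?_)
    · have h1 := hζD (z.1.1 - z.1.2)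
      have h2 := haC (z.1.1, z.2)
      have h3 := hbC (z.1.2, z.2)
      rw [Real.norm_eq_abs] at h1
      simp only [abs_mul]
      have : 0 ≤ C := (abs_nonneg _).trans h2
      gcongr
    · rcases lt_or_ge R ‖(z.1.2, z.2)‖ with h | h
      · simp [hbR _ h]
      · rw [hζs, zero_mul]
        rw [Prod.norm_def, max_le_iff] at h
        rw [Prod.norm_def, Prod.norm_def, lt_max_iff, lt_max_iff] at hz
        have := (φ n).rOut_pos
        rcases hz with (h3 | h3) | h3
        · linarith [norm_sub_norm_le z.1.1 z.1.2, h.1]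
        · linarith [h.1]
        · linarith [h.2]
  have hbi : Integrable b := integrable_of_bounded_of_support hb hbC hbR
  have hab : Integrable fun p => a p * b p :=
    integrable_of_bounded_of_support (by fun_prop) (C := C * C) (R := R) (fun p => by
      have h2 := haC p
      have h3 := hbC p
      rw [abs_mul]
      have : 0 ≤ C := (abs_nonneg _).trans h2
      gcongr) fun p hp => by simp [hbR p hp]
  refine ⟨hi, hab, ?_⟩
  have key := fun m => tendsto_integral_bump_mul hφ hφ' (a := fun s => a (s, m))
    (b := fun t => b (t, m)) (by fun_prop) (by fun_prop) (C := C) (R := R) (fun s => haC _)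
    (fun t => hbC _) fun t ht => hbR _ (ht.trans_le (le_max_left _ _))
  have e : ∀ n, ∫ z : (ℝ × ℝ) × Z, (φ n).normed volume (z.1.1 - z.1.2) *
      (a (z.1.1, z.2) * b (z.1.2, z.2)) = ∫ m, ∫ z : ℝ × ℝ, (φ n).normed volume (z.1 - z.2) *
      (a (z.1, m) * b (z.2, m)) := fun n => integral_prod_symm _ (hi n)
  simp only [e]
  rw [show ∫ p, a p * b p = ∫ m, ∫ t, a (t, m) * b (t, m) from integral_prod_symm _ hab]
  refine tendsto_integral_of_dominated_convergence (fun m => C * ∫ t, |b (t, m)|) (fun n => ?_)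
    (hbi.norm.integral_prod_right.const_mul C) (fun n => Eventually.of_forall fun m => (key m).1 n)
    (Eventually.of_forall fun m => (key m).2)
  exact (hi n).integral_prod_right.aestronglyMeasurable

theorem measurePreserving_prodProdProdComm (α β γ δ : Type*) [MeasureSpace α] [MeasureSpace β]
    [MeasureSpace γ] [MeasureSpace δ] [SFinite (volume : Measure α)]
    [SFinite (volume : Measure β)] [SFinite (volume : Measure γ)] [SFinite (volume : Measure δ)] :
    MeasurePreserving (Equiv.prodProdProdComm α β γ δ) := by
  have h1 : MeasurePreserving (MeasurableEquiv.prodAssoc : (α × β) × γ × δ ≃ᵐ α × β × γ × δ) :=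
    measurePreserving_prodAssoc _ _ _
  have h2 : MeasurePreserving (MeasurableEquiv.prodAssoc : (β × γ) × δ ≃ᵐ β × γ × δ) :=
    measurePreserving_prodAssoc _ _ _
  have h3 : MeasurePreserving (Prod.swap : β × γ → γ × β) := Measure.measurePreserving_swap
  have h4 : MeasurePreserving (MeasurableEquiv.prodAssoc : (γ × β) × δ ≃ᵐ γ × β × δ) :=
    measurePreserving_prodAssoc _ _ _
  have h5 : MeasurePreserving (MeasurableEquiv.prodAssoc : (α × γ) × β × δ ≃ᵐ α × γ × β × δ) :=
    measurePreserving_prodAssoc _ _ _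
  have h6 := h4.comp ((h3.prod (MeasurePreserving.id (volume : Measure δ))).comp h2.symm)
  exact h5.symm.comp (((MeasurePreserving.id (volume : Measure α)).prod h6).comp h1)

theorem integral_prodProdProdComm {α β γ δ : Type*} [MeasureSpace α] [MeasureSpace β]
    [MeasureSpace γ] [MeasureSpace δ] [SFinite (volume : Measure α)]
    [SFinite (volume : Measure β)] [SFinite (volume : Measure γ)] [SFinite (volume : Measure δ)]
    (g : (α × γ) × β × δ → ℝ) :
    ∫ z : (α × β) × γ × δ, g ((z.1.1, z.2.1), z.1.2, z.2.2) = ∫ z, g z :=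
  (measurePreserving_prodProdProdComm α β γ δ).integral_comp
    (MeasurableEquiv.measurableEmbedding
      { toEquiv := Equiv.prodProdProdComm α β γ δ
        measurable_toFun := (measurePreserving_prodProdProdComm α β γ δ).measurable
        measurable_invFun := (measurePreserving_prodProdProdComm α γ β δ).measurable }) g

theorem isTest_exists_time_margin {T : ℝ} {Ψ : Phase → ℝ} (hΨ : IsTest T Ψ) :
    ∃ δ, 0 < δ ∧ ∀ q, Ψ q ≠ 0 → ∀ s, |s| ≤ δ → q.1 + s ∈ Ioo 0 T := by
  have hK : IsCompact (Prod.fst '' tsupport Ψ) := hΨ.compact.isCompact.image continuous_fst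
  obtain ⟨δ, hδ, h⟩ := hK.exists_cthickening_subset_open (isOpen_Ioo (a := (0 : ℝ)) (b := T)) (by
    rintro _ ⟨q, hq, rfl⟩
    exact (hΨ.supp hq).1)
  refine ⟨δ, hδ, fun q hq s hs => h ?_⟩
  exact Metric.mem_cthickening_of_dist_le _ _ _ _ ⟨q, subset_tsupport _ hq, rfl⟩
    (by simpa [Real.dist_eq] using hs)

theorem fderiv_mul_prod {X Y : Type*} [NormedAddCommGroup X] [NormedSpace ℝ X]
    [NormedAddCommGroup Y] [NormedSpace ℝ Y] {a : X → ℝ} {b : Y → ℝ} (ha : Differentiable ℝ a)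
    (hb : Differentiable ℝ b) (q v : X × Y) :
    fderiv ℝ (fun q : X × Y => a q.1 * b q.2) q v
      = fderiv ℝ a q.1 v.1 * b q.2 + a q.1 * fderiv ℝ b q.2 v.2 := by
  have h1 : HasFDerivAt (fun q : X × Y => a q.1) _ q := (ha q.1).hasFDerivAt.comp q hasFDerivAt_fst
  have h2 : HasFDerivAt (fun q : X × Y => b q.2) _ q := (hb q.2).hasFDerivAt.comp q hasFDerivAt_snd
  rw [(h1.fun_mul h2).fderiv]
  simp
  ring

theorem hasCompactSupport_of_lt_norm {X F : Type*} [NormedAddCommGroup X] [ProperSpace X] [Zero F]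
    {k : X → F} {r : ℝ} (h : ∀ z, r < ‖z‖ → k z = 0) : HasCompactSupport k :=
  (isCompact_closedBall 0 r).of_isClosed_subset (isClosed_tsupport k)
    (tsupport_subset_closedBall h)

theorem WeakSol.integral_doubling_prod {T : ℝ} {A : Phase → E3 × E3} {u Ψ : Phase → ℝ}
    {ζ : ℝ → ℝ} {k : E3 × E3 → ℝ} {r δ : ℝ} (hw : WeakSol T A u) (hu : MeasBdd u) (hA : MeasBdd A)
    (hΨ : IsTest T Ψ) (hδ : ∀ q, Ψ q ≠ 0 → ∀ s, |s| ≤ δ → q.1 + s ∈ Ioo 0 T)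
    (hζ : ContDiff ℝ (⊤ : ℕ∞) ζ) (hζs : ∀ s, δ < ‖s‖ → ζ s = 0)
    (hk : ContDiff ℝ (⊤ : ℕ∞) k) (hks : ∀ z, r < ‖z‖ → k z = 0) :
    ∫ z : (ℝ × ℝ) × (E3 × E3) × (E3 × E3), u (z.1.1, z.2.1) * u (z.1.2, z.2.2) *
      (ζ (z.1.1 - z.1.2) * (fderiv ℝ Ψ (z.1.2, z.2.2) (1, A (z.1.2, z.2.2)) * k (z.2.1 - z.2.2)
      + Ψ (z.1.2, z.2.2) * fderiv ℝ k (z.2.1 - z.2.2) (A (z.1.1, z.2.1) - A (z.1.2, z.2.2))))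
      = 0 := by
  let κ : Phase → ℝ := fun q => ζ q.1 * k q.2
  have hκ : ContDiff ℝ (⊤ : ℕ∞) κ := (hζ.comp contDiff_fst).mul (hk.comp contDiff_snd)
  have hκs : ∀ q, max δ r < ‖q‖ → κ q = 0 := fun q hq => by
    rw [Prod.norm_def, lt_max_iff, max_lt_iff, max_lt_iff] at hq
    rcases hq with h | h
    · simp [κ, hζs _ h.1]
    · simp [κ, hks _ h.2]
  have hκt : tsupport κ ⊆ {q | ‖q.1‖ ≤ δ} := by
    refine closure_minimal (fun q hq => ?_) (isClosed_le (by fun_prop) continuous_const)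
    by_contra h
    exact hq (by simp [κ, hζs _ (not_le.1 h)])
  have hd := hw.integral_doubling hu hA hΨ hκ (hasCompactSupport_of_lt_norm hκs) fun q hq p hp =>
    ⟨hδ q hq p.1 (hκt hp), mem_univ _⟩
  rw [← integral_prodProdProdComm]
  refine Eq.trans ?_ hd
  refine integral_congr_ae (Filter.Eventually.of_forall fun z => ?_)
  have hfd : fderiv ℝ κ (z.1 - z.2) (0, A z.1 - A z.2)
      = ζ (z.1.1 - z.2.1) * fderiv ℝ k (z.1.2 - z.2.2) (A z.1 - A z.2) := by
    simp only [κ]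
    rw [fderiv_mul_prod (hζ.differentiable (by simp)) (hk.differentiable (by simp))]
    simp
  simp only [hfd]
  simp only [κ, Prod.fst_sub, Prod.snd_sub]
  ring

open Filter Topology in
theorem WeakSol.integral_doubling_space {T : ℝ} {A : Phase → E3 × E3} {u Ψ : Phase → ℝ}
    {k : E3 × E3 → ℝ} {r : ℝ} (hw : WeakSol T A u) (hu : MeasBdd u) (hA : MeasBdd A)
    (hΨ : IsTest T Ψ) (hk : ContDiff ℝ (⊤ : ℕ∞) k) (hks : ∀ z, r < ‖z‖ → k z = 0) :
    ∫ p : ℝ × (E3 × E3) × (E3 × E3), u (p.1, p.2.1) * u (p.1, p.2.2) *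
      (fderiv ℝ Ψ (p.1, p.2.2) (1, A (p.1, p.2.2)) * k (p.2.1 - p.2.2)
      + Ψ (p.1, p.2.2) * fderiv ℝ k (p.2.1 - p.2.2) (A (p.1, p.2.1) - A (p.1, p.2.2))) = 0 := by
  let φ : ℕ → ContDiffBump (0 : ℝ) := fun n =>
    ⟨1 / ((n : ℝ) + 1) / 2, 1 / ((n : ℝ) + 1), by positivity, half_lt_self (by positivity)⟩
  have hφ : Tendsto (fun n => (φ n).rOut) atTop (𝓝 0) := tendsto_one_div_add_atTop_nhds_zero_nat
  have hφ' : ∀ n, (φ n).rOut ≤ 2 * (φ n).rIn := fun n => by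
    simp only [φ]
    linarith
  obtain ⟨C, R, hC, hR, hΨb, hΨb', hΨs, hΨs'⟩ := hΨ.exists_bound
  obtain ⟨M, hM, huM⟩ := hu.exists_nonneg_bound
  obtain ⟨N, hN, hAN⟩ := hA.exists_nonneg_bound
  have hks' : ∀ p, r < ‖p‖ → fderiv ℝ k p = 0 := fun p hp => fderiv_eq_zero_of_lt_norm hks hp
  obtain ⟨D, hD, hkb⟩ := exists_bound_of_lt_norm hk.continuous hks
  obtain ⟨D', hD', hkb'⟩ := exists_bound_of_lt_norm (hk.continuous_fderiv (by simp)) hks'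
  have hmu := hu.measurable
  have hmA := hA.measurable
  have hmΨ := hΨ.smooth.continuous.measurable
  have hmΨ' := hΨ.continuous_fderiv.measurable
  have hmk := hk.continuous.measurable
  have hmk' := (hk.continuous_fderiv (by simp)).measurable
  have hu1 : ∀ p, |u p| ≤ M := huM
  have hkA : ∀ q p, |fderiv ℝ k q (A p)| ≤ D' * N := fun q p =>
    ((fderiv ℝ k q).le_opNorm _).trans (mul_le_mul (hkb' q) (hAN p) (norm_nonneg _) hD')
  have hΨA : ∀ p, |fderiv ℝ Ψ p (1, A p)| ≤ C * max 1 N := fun p => by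
    refine ((fderiv ℝ Ψ p).le_opNorm _).trans (mul_le_mul (hΨb' p) ?_ (norm_nonneg _) hC)
    rw [Prod.norm_def]
    exact max_le_max (by simp) (hAN p)
  let S : ℝ × (E3 × E3) × (E3 × E3) → ℝ := fun p => if ‖p.2.1 - p.2.2‖ ≤ r then 1 else 0
  have hmS : Measurable S :=
    measurable_const.ite (measurableSet_le (by fun_prop) measurable_const) measurable_const
  have hS1 : ∀ p, |S p| ≤ 1 := fun p => by
    by_cases h : ‖p.2.1 - p.2.2‖ ≤ r <;> simp [S, h]
  have hS0 : ∀ p, r < ‖p.2.1 - p.2.2‖ → S p = 0 := fun p h => by simp [S, h]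
  let a₀ : ℝ × (E3 × E3) × (E3 × E3) → ℝ := fun p => u (p.1, p.2.1)
  let b₀ : ℝ × (E3 × E3) × (E3 × E3) → ℝ := fun p => u (p.1, p.2.2) *
    (fderiv ℝ Ψ (p.1, p.2.2) (1, A (p.1, p.2.2)) * k (p.2.1 - p.2.2)
      - Ψ (p.1, p.2.2) * fderiv ℝ k (p.2.1 - p.2.2) (A (p.1, p.2.2)))
  let a₁ : ℝ × (E3 × E3) × (E3 × E3) → ℝ := fun p =>
    u (p.1, p.2.1) * fderiv ℝ k (p.2.1 - p.2.2) (A (p.1, p.2.1))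
  let b₁ : ℝ × (E3 × E3) × (E3 × E3) → ℝ := fun p => S p * (u (p.1, p.2.2) * Ψ (p.1, p.2.2))
  have hcut : ∀ p : ℝ × (E3 × E3) × (E3 × E3), max R (R + r) < ‖p‖ →
      R < ‖(p.1, p.2.2)‖ ∨ r < ‖p.2.1 - p.2.2‖ := fun p hp => by
    rw [Prod.norm_def, Prod.norm_def, lt_max_iff, lt_max_iff, max_lt_iff, max_lt_iff,
      max_lt_iff] at hp
    rw [Prod.norm_def, lt_max_iff]
    rcases hp with h | h | h
    · exact .inl (.inl h.1)
    · by_cases h' : R < ‖p.2.2‖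
      · exact .inl (.inr h')
      · right; linarith [norm_sub_norm_le p.2.1 p.2.2, h.2]
    · exact .inl (.inr h.1)
  obtain ⟨i₀, j₀, l₀⟩ := tendsto_integral_bump_mul_prod hφ hφ' (a := a₀) (b := b₀) (by fun_prop)
    (by fun_prop) (C := max M (M * (C * max 1 N * D + C * (D' * N)))) (R := max R (R + r))
    (fun p => (hu1 _).trans (le_max_left _ _)) (fun p => le_max_of_le_right (by
      have h1 := hu1 (p.1, p.2.2)
      have h2 := hΨA (p.1, p.2.2)
      have h3 := hΨb (p.1, p.2.2)
      have h4 : |k (p.2.1 - p.2.2)| ≤ D := hkb _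
      have h5 := hkA (p.2.1 - p.2.2) (p.1, p.2.2)
      simp only [b₀]
      rw [abs_mul]
      refine mul_le_mul h1 ((abs_sub _ _).trans ?_) (abs_nonneg _) hM
      simp only [abs_mul]
      gcongr)) (fun p hp => by
      rcases hcut p hp with h | h
      · simp [b₀, hΨs _ h, hΨs' _ h]
      · simp [b₀, hks _ h, hks' _ h])
  obtain ⟨i₁, j₁, l₁⟩ := tendsto_integral_bump_mul_prod hφ hφ' (a := a₁) (b := b₁) (by fun_prop)
    (by fun_prop) (C := max (M * (D' * N)) (1 * (M * C))) (R := max R (R + r))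
    (fun p => le_max_of_le_left (by
      have h1 := hu1 (p.1, p.2.1)
      have h5 := hkA (p.2.1 - p.2.2) (p.1, p.2.1)
      simp only [a₁, abs_mul]
      gcongr)) (fun p => le_max_of_le_right (by
      have h1 := hu1 (p.1, p.2.2)
      have h3 := hΨb (p.1, p.2.2)
      have h4 := hS1 p
      simp only [b₁, abs_mul]
      gcongr)) (fun p hp => by
      rcases hcut p hp with h | h
      · simp [b₁, hΨs _ h]
      · simp [b₁, hS0 _ h])
  have hb1 : ∀ s t X, a₁ (s, X) * b₁ (t, X) = u (s, X.1) * fderiv ℝ k (X.1 - X.2) (A (s, X.1)) *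
      (u (t, X.2) * Ψ (t, X.2)) := fun s t X => by
    rcases lt_or_ge r ‖X.1 - X.2‖ with h | h
    · simp [a₁, hks' _ h]
    · simp [a₁, b₁, S, h]
  have hlim := l₀.add l₁
  obtain ⟨δ, hδ, hmargin⟩ := isTest_exists_time_margin hΨ
  have hev : ∀ᶠ n in atTop, (φ n).rOut ≤ δ := hφ.eventually_le_const hδ
  have hzero : ∀ᶠ n in atTop, (∫ z : (ℝ × ℝ) × (E3 × E3) × (E3 × E3),
      (φ n).normed volume (z.1.1 - z.1.2) * (a₀ (z.1.1, z.2) * b₀ (z.1.2, z.2)))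
      + ∫ z : (ℝ × ℝ) × (E3 × E3) × (E3 × E3),
      (φ n).normed volume (z.1.1 - z.1.2) * (a₁ (z.1.1, z.2) * b₁ (z.1.2, z.2)) = 0 := by
    filter_upwards [hev] with n hn
    have hd := hw.integral_doubling_prod hu hA hΨ hmargin (φ n).contDiff_normed (fun s hs =>
      eq_zero_of_lt_norm_of_tsupport ((φ n).tsupport_normed_eq (μ := volume)).le
        (hn.trans_lt hs)) hk hks
    rw [← integral_add (i₀ n) (i₁ n)]
    refine Eq.trans ?_ hd
    refine integral_congr_ae (Eventually.of_forall fun z => ?_)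
    simp only [hb1, a₀, b₀, map_sub]
    ring
  have h0 := tendsto_nhds_unique_of_eventuallyEq hlim tendsto_const_nhds hzero
  rw [← integral_add j₀ j₁] at h0
  refine Eq.trans ?_ h0
  refine integral_congr_ae (Eventually.of_forall fun p => ?_)
  simp only [hb1 p.1 p.1 p.2, a₀, b₀, map_sub]
  ring

theorem abs_integral_le_of_abs_le_comp_sub {Y : Type*} [NormedAddCommGroup Y] [ProperSpace Y]
    [MeasureSpace Y] [BorelSpace Y] [SFinite (volume : Measure Y)]
    [(volume : Measure Y).IsAddRightInvariant] [IsFiniteMeasureOnCompacts (volume : Measure Y)]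
    {g : Y × Y → ℝ} {h : Y → ℝ} {c R : ℝ} (hc : 0 ≤ c) (hh : Integrable h) (h0 : ∀ y, 0 ≤ h y)
    (hg : ∀ z, |g z| ≤ c * h (z.1 - z.2)) (hs : ∀ z, R < ‖z.2‖ → g z = 0) :
    |∫ z, g z| ≤ c * (∫ y, h y) * volume.real (Metric.closedBall (0 : Y) R) := by
  by_cases hi : Integrable g
  swap
  · rw [integral_undef hi, abs_zero]
    have := integral_nonneg (μ := volume) (f := h) h0
    positivity
  rw [Measure.volume_eq_prod, integral_prod_symm _ hi]
  have h1 : ∀ y, ‖∫ x, g (x, y)‖ ≤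
      (Metric.closedBall (0 : Y) R).indicator (fun _ => c * ∫ y, h y) y := fun y => by
    by_cases hy : y ∈ Metric.closedBall (0 : Y) R
    · rw [indicator_of_mem hy, ← integral_sub_right_eq_self h y, ← integral_const_mul]
      exact norm_integral_le_of_norm_le ((hh.comp_sub_right y).const_mul c)
        (Filter.Eventually.of_forall fun x => hg (x, y))
    · rw [indicator_of_notMem hy]
      simp only [Metric.mem_closedBall, dist_zero_right, not_le] at hy
      simp [hs (_, y) hy]
  have h2 : ∫ y, (Metric.closedBall (0 : Y) R).indicator (fun _ => c * ∫ y, h y) y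
      = c * (∫ y, h y) * volume.real (Metric.closedBall (0 : Y) R) := by
    rw [integral_indicator Metric.isClosed_closedBall.measurableSet, setIntegral_const,
      smul_eq_mul, mul_comm]
  refine le_of_le_of_eq ?_ h2
  rw [← Real.norm_eq_abs]
  refine norm_integral_le_of_norm_le ?_ (Filter.Eventually.of_forall h1)
  exact (integrable_indicator_iff Metric.isClosed_closedBall.measurableSet).2
    (integrableOn_const (isCompact_closedBall _ _).measure_lt_top.ne)

namespace IsKernel

variable {A r : ℝ} {k : E3 → ℝ}

theorem integral_fderiv_apply (hk : IsKernel A r k) (v : E3) : ∫ z, fderiv ℝ k z v = 0 := by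
  have h := integral_neg_eq_self (fun z => fderiv ℝ k z v) volume
  have h2 : ∫ z, fderiv ℝ k (-z) v = -∫ z, fderiv ℝ k z v := by
    rw [← integral_neg]
    simp [hk.fderiv_neg]
  linarith

theorem measurable_fderiv (hk : IsKernel A r k) : Measurable (fderiv ℝ k) :=
  hk.continuous_fderiv.measurable

theorem exists_fderiv_bound (hk : IsKernel A r k) : ∃ C, 0 ≤ C ∧ ∀ z, ‖fderiv ℝ k z‖ ≤ C :=
  exists_bound_of_lt_norm hk.continuous_fderiv fun _ h => hk.fderiv_supp h

theorem exists_bound (hk : IsKernel A r k) : ∃ C, 0 ≤ C ∧ ∀ z, |k z| ≤ C :=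
  exists_bound_of_lt_norm hk.smooth.continuous hk.supp

theorem measurable (hk : IsKernel A r k) : Measurable k := hk.smooth.continuous.measurable

/-- Integrability of the commutator-type integrands. -/
theorem integrable_mul_fderiv_sub (hk : IsKernel A r k) {U : E3 × E3 → ℝ} {V : E3 × E3 → E3}
    {M N R : ℝ} (hU : Measurable U) (hV : Measurable V)
    (hM : 0 ≤ M) (hUM : ∀ z, |U z| ≤ M) (hVN : ∀ z, ‖V z‖ ≤ N)
    (hVs : ∀ z, R < ‖z.2‖ → V z = 0) :
    Integrable fun z : E3 × E3 => U z * fderiv ℝ k (z.1 - z.2) (V z) := by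
  obtain ⟨C, hC, hkC⟩ := hk.exists_fderiv_bound
  have := hk.measurable_fderiv
  refine integrable_of_bounded_of_sub_support (by fun_prop) (C := M * (C * N)) (R := R) (r := r)
    (fun z => ?_) (fun z hz => by simp [hVs z hz]) (fun z hz => by simp [hk.fderiv_supp hz])
  rw [abs_mul]
  exact mul_le_mul (hUM z) (((fderiv ℝ k _).le_opNorm _).trans
    (mul_le_mul (hkC _) (hVN z) (norm_nonneg _) hC)) (abs_nonneg _) hM

/-- The bound given by the total mass of the derivative of the kernel. -/
theorem abs_integral_mul_fderiv_sub_le (hk : IsKernel A r k) {U : E3 × E3 → ℝ}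
    {V : E3 × E3 → E3} {M N R : ℝ} (hM : 0 ≤ M) (hN : 0 ≤ N)
    (hU : ∀ z, ‖z.1 - z.2‖ ≤ r → |U z| ≤ M) (hV : ∀ z, ‖z.1 - z.2‖ ≤ r → ‖V z‖ ≤ N)
    (hVs : ∀ z, R < ‖z.2‖ → ‖z.1 - z.2‖ ≤ r → V z = 0) :
    |∫ z : E3 × E3, U z * fderiv ℝ k (z.1 - z.2) (V z)|
      ≤ M * N * (A / r) * volume.real (Metric.closedBall (0 : E3) R) := by
  refine (abs_integral_le_of_abs_le_comp_sub (c := M * N) (R := R) (mul_nonneg hM hN)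
    hk.integrable_norm_fderiv (fun _ => norm_nonneg _) (fun z => ?_) (fun z hz => ?_)).trans ?_
  · rcases lt_or_ge r ‖z.1 - z.2‖ with h | h
    · simp [hk.fderiv_supp h]
    · rw [abs_mul, mul_assoc, mul_comm N]
      exact mul_le_mul (hU z h) (((fderiv ℝ k _).le_opNorm _).trans
        (mul_le_mul_of_nonneg_left (hV z h) (norm_nonneg _))) (abs_nonneg _) hM
  · rcases lt_or_ge r ‖z.1 - z.2‖ with h | h
    · simp [hk.fderiv_supp h]
    · simp [hVs z hz h]
  · have := hk.integral_fderiv_le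
    gcongr

/-- The commutator estimate. -/
theorem abs_integral_commutator_le (hk : IsKernel A r k) (hr : 0 ≤ r) (hr1 : r ≤ 1) {U U₂ : E3 → ℝ}
    {V : E3 → E3} {M N R K η : ℝ} (hU : Measurable U) (hU₂ : Measurable U₂) (hV : Measurable V)
    (hN : 0 ≤ N) (hK : 0 ≤ K) (hUM : ∀ a, |U a| ≤ M)
    (hUK : ∀ a b, ‖a - b‖ ≤ r → |U a - U b| ≤ K) (hη : ∀ a, |U₂ a - U a| ≤ η)
    (hVN : ∀ a, ‖V a‖ ≤ N) (hVL : ∀ a b, ‖V a - V b‖ ≤ N * ‖a - b‖)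
    (hVs : ∀ a, R < ‖a‖ → V a = 0) :
    |∫ z : E3 × E3, U z.1 * U₂ z.2 * fderiv ℝ k (z.1 - z.2) (V z.2)|
      ≤ (K * η * N + M ^ 2 * (N * r)) * (A / r)
        * volume.real (Metric.closedBall (0 : E3) (R + 1)) := by
  have hM : 0 ≤ M := (abs_nonneg _).trans (hUM 0)
  have hη0 : 0 ≤ η := (abs_nonneg _).trans (hη 0)
  have hVs' : ∀ z : E3 × E3, R + 1 < ‖z.2‖ → V z.2 = 0 := fun z hz => hVs _ (by linarith)
  have i1 : Integrable fun z : E3 × E3 =>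
      (U z.1 - U z.2) * (U₂ z.2 - U z.2) * fderiv ℝ k (z.1 - z.2) (V z.2) := by
    refine hk.integrable_mul_fderiv_sub (U := fun z => (U z.1 - U z.2) * (U₂ z.2 - U z.2))
      (V := fun z => V z.2) (M := (M + M) * η) (by fun_prop) (by fun_prop) (by positivity)
      (fun z => ?_) (fun z => hVN _) hVs'
    rw [abs_mul]
    exact mul_le_mul ((abs_sub _ _).trans (add_le_add (hUM _) (hUM _))) (hη _) (abs_nonneg _)
      (by positivity)
  have i2 : Integrable fun z : E3 × E3 => U z.1 * U z.2 * fderiv ℝ k (z.1 - z.2) (V z.2) := by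
    refine hk.integrable_mul_fderiv_sub (U := fun z => U z.1 * U z.2)
      (V := fun z => V z.2) (M := M * M) (by fun_prop) (by fun_prop) (by positivity)
      (fun z => ?_) (fun z => hVN _) hVs'
    rw [abs_mul]
    exact mul_le_mul (hUM _) (hUM _) (abs_nonneg _) hM
  have i3 : Integrable fun z : E3 × E3 =>
      (U z.2 * (U₂ z.2 - U z.2)) * fderiv ℝ k (z.1 - z.2) (V z.2) := by
    refine hk.integrable_mul_fderiv_sub (U := fun z => U z.2 * (U₂ z.2 - U z.2))
      (V := fun z => V z.2) (M := M * η) (by fun_prop) (by fun_prop) (by positivity)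
      (fun z => ?_) (fun z => hVN _) hVs'
    rw [abs_mul]
    exact mul_le_mul (hUM _) (hη _) (abs_nonneg _) hM
  have e3 : ∫ z : E3 × E3, (U z.2 * (U₂ z.2 - U z.2)) * fderiv ℝ k (z.1 - z.2) (V z.2) = 0 := by
    rw [Measure.volume_eq_prod, integral_prod_symm _ i3]
    refine integral_eq_zero_of_ae (Filter.Eventually.of_forall fun b => ?_)
    simp only [integral_const_mul, Pi.zero_apply]
    rw [integral_sub_right_eq_self (fun a => fderiv ℝ k a (V b)) b, hk.integral_fderiv_apply,
      mul_zero]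
  have e2 : ∫ z : E3 × E3, U z.1 * U z.2 * fderiv ℝ k (z.1 - z.2) (V z.1)
      = -∫ z : E3 × E3, U z.1 * U z.2 * fderiv ℝ k (z.1 - z.2) (V z.2) := by
    rw [← integral_neg, Measure.volume_eq_prod, ← integral_prod_swap]
    refine integral_congr_ae (Filter.Eventually.of_forall fun z => ?_)
    simp only [Prod.fst_swap, Prod.snd_swap]
    rw [← neg_sub z.1 z.2, hk.fderiv_neg, neg_apply]
    ring
  have i2' : Integrable fun z : E3 × E3 => U z.1 * U z.2 * fderiv ℝ k (z.1 - z.2) (V z.1) := by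
    refine (integrable_swap_iff (μ := volume) (ν := volume)).1 ?_
    refine i2.neg.congr (Filter.Eventually.of_forall fun z => ?_)
    simp only [Function.comp, Prod.fst_swap, Prod.snd_swap, Pi.neg_apply]
    rw [← neg_sub z.1 z.2, hk.fderiv_neg, neg_apply]
    ring
  have b1 : |∫ z : E3 × E3,
      (U z.1 - U z.2) * (U₂ z.2 - U z.2) * fderiv ℝ k (z.1 - z.2) (V z.2)|
      ≤ K * η * N * (A / r) * volume.real (Metric.closedBall (0 : E3) (R + 1)) := by
    refine hk.abs_integral_mul_fderiv_sub_le (by positivity) hN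
      (U := fun z => (U z.1 - U z.2) * (U₂ z.2 - U z.2)) (V := fun z => V z.2) (fun z hz => ?_)
      (fun z _ => hVN _) (fun z hz _ => hVs' z hz)
    rw [abs_mul]
    exact mul_le_mul (hUK _ _ hz) (hη _) (abs_nonneg _) hK
  have b2 : |∫ z : E3 × E3, U z.1 * U z.2 * fderiv ℝ k (z.1 - z.2) (V z.2 - V z.1)|
      ≤ M * M * (N * r) * (A / r) * volume.real (Metric.closedBall (0 : E3) (R + 1)) := by
    refine hk.abs_integral_mul_fderiv_sub_le (by positivity) (by positivity)
      (U := fun z => U z.1 * U z.2) (V := fun z => V z.2 - V z.1) (fun z hz => ?_)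
      (fun z hz => ?_) (fun z hz hz' => ?_)
    · rw [abs_mul]
      exact mul_le_mul (hUM _) (hUM _) (abs_nonneg _) hM
    · rw [norm_sub_rev]
      exact (hVL _ _).trans (mul_le_mul_of_nonneg_left hz hN)
    · rw [hVs' z hz, hVs z.1 (by linarith [norm_sub_norm_le z.2 z.1, norm_sub_rev z.1 z.2]),
        sub_zero]
  have e4 : ∫ z : E3 × E3, U z.1 * U z.2 * fderiv ℝ k (z.1 - z.2) (V z.2 - V z.1)
      = 2 * ∫ z : E3 × E3, U z.1 * U z.2 * fderiv ℝ k (z.1 - z.2) (V z.2) := by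
    simp only [map_sub, mul_sub]
    rw [integral_sub i2 i2', e2]
    ring
  rw [e4, abs_mul, abs_two] at b2
  have e5 : ∫ z : E3 × E3, U z.1 * U₂ z.2 * fderiv ℝ k (z.1 - z.2) (V z.2)
      = (∫ z : E3 × E3, (U z.1 - U z.2) * (U₂ z.2 - U z.2) * fderiv ℝ k (z.1 - z.2) (V z.2))
        + ∫ z : E3 × E3, U z.1 * U z.2 * fderiv ℝ k (z.1 - z.2) (V z.2) := by
    have i23 : Integrable fun z : E3 × E3 => U z.1 * U z.2 * fderiv ℝ k (z.1 - z.2) (V z.2)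
        + (U z.2 * (U₂ z.2 - U z.2)) * fderiv ℝ k (z.1 - z.2) (V z.2) := i2.add i3
    have e6 := integral_add i1 i23
    rw [integral_add i2 i3, e3, add_zero] at e6
    rw [← e6]
    refine integral_congr_ae (Filter.Eventually.of_forall fun z => ?_)
    ring
  rw [e5]
  refine (abs_add_le _ _).trans ?_
  have := abs_nonneg (∫ z : E3 × E3, U z.1 * U z.2 * fderiv ℝ k (z.1 - z.2) (V z.2))
  linarith

end IsKernel

/-- Fubini form of `abs_integral_le_of_abs_le_comp_sub`. -/
theorem IsKernel.abs_integral_le_of_abs_inner_le {A s : ℝ} {h : E3 → ℝ} (hh : IsKernel A s h)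
    {g : (E3 × E3) × E3 × E3 → ℝ} {c R : ℝ} (hc : 0 ≤ c)
    (hg : ∀ y, |∫ z, g (z, y)| ≤ c * h (y.1 - y.2)) (hs : ∀ z y, R < ‖y.2‖ → g (z, y) = 0) :
    |∫ p, g p| ≤ c * volume.real (Metric.closedBall (0 : E3) R) := by
  by_cases hi : Integrable g
  swap
  · rw [integral_undef hi, abs_zero]
    positivity
  have e : ∫ p, g p = ∫ y, ∫ z, g (z, y) := integral_prod_symm _ hi
  rw [e]
  have hint : Integrable h :=
    hh.smooth.continuous.integrable_of_hasCompactSupport hh.hasCompactSupport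
  refine (abs_integral_le_of_abs_le_comp_sub (R := R) hc hint hh.nonneg hg
    fun y hy => ?_).trans_eq ?_
  · simp [hs _ y hy]
  · rw [hh.integral_eq, mul_one]

/-- The commutator estimate with parameters. -/
theorem IsKernel.abs_integral_commutator_prod_le {A r s : ℝ} {k h : E3 → ℝ} (hk : IsKernel A r k)
    (hh : IsKernel A s h) (hA : 0 ≤ A) (hr : 0 ≤ r) (hr1 : r ≤ 1) {P : E3 × E3 → ℝ}
    {V : E3 × E3 → E3 → E3} {M N R K η : ℝ} (hP : Measurable P) (hV : ∀ y, Measurable (V y))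
    (hN : 0 ≤ N) (hK : 0 ≤ K) (hη : 0 ≤ η) (hPM : ∀ z, |P z| ≤ M)
    (hPK : ∀ a b y, ‖a - b‖ ≤ r → |P (a, y) - P (b, y)| ≤ K)
    (hPη : ∀ a y y', ‖y - y'‖ ≤ s → |P (a, y) - P (a, y')| ≤ η)
    (hVN : ∀ y a, ‖y.1 - y.2‖ ≤ s → ‖V y a‖ ≤ N)
    (hVL : ∀ y a b, ‖y.1 - y.2‖ ≤ s → ‖V y a - V y b‖ ≤ N * ‖a - b‖)
    (hVs : ∀ y a, R < ‖a‖ → V y a = 0) (hVs' : ∀ y a, R < ‖y.2‖ → V y a = 0) :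
    |∫ z : (E3 × E3) × E3 × E3, P (z.1.1, z.2.1) * P (z.1.2, z.2.2) *
        (fderiv ℝ k (z.1.1 - z.1.2) (V z.2 z.1.2) * h (z.2.1 - z.2.2))|
      ≤ (K * η * N + M ^ 2 * (N * r)) * (A / r) * volume.real (Metric.closedBall (0 : E3) (R + 1))
        * volume.real (Metric.closedBall (0 : E3) R) := by
  refine hh.abs_integral_le_of_abs_inner_le (by positivity) (fun y => ?_)
    (fun z y hy => by simp [hVs' y _ hy])
  rcases lt_or_ge s ‖y.1 - y.2‖ with hy | hy
  · simp [hh.supp _ hy]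
  have e : ∀ z : E3 × E3, P (z.1, y.1) * P (z.2, y.2) *
      (fderiv ℝ k (z.1 - z.2) (V y z.2) * h (y.1 - y.2))
      = P (z.1, y.1) * P (z.2, y.2) * fderiv ℝ k (z.1 - z.2) (V y z.2) * h (y.1 - y.2) :=
    fun z => by ring
  simp only [e]
  rw [integral_mul_const, abs_mul, abs_of_nonneg (hh.nonneg _)]
  refine mul_le_mul_of_nonneg_right ?_ (hh.nonneg _)
  exact hk.abs_integral_commutator_le (U := fun a => P (a, y.1)) (U₂ := fun a => P (a, y.2)) hr hr1
    (by fun_prop) (by fun_prop) (hV y) hN hK (fun a => hPM _) (fun a b => hPK a b _)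
    (fun a => hPη _ _ _ (by rwa [norm_sub_rev])) (fun a => hVN y a hy) (fun a b => hVL y a b hy)
    (fun a => hVs y a)

theorem IsKernel.integral_fderiv_sub_cross3_relV {A r : ℝ} {k : E3 → ℝ} (hk : IsKernel A r k)
    (b c : E3) : ∫ a, fderiv ℝ k (a - b) (cross3 (relV a - relV b) c) = 0 := by
  have h1 : ∀ a, fderiv ℝ k (a - b) = fderiv ℝ (fun a => k (a - b)) a := fun a =>
    (fderiv_comp_sub b).symm
  have hs : ContDiff ℝ (⊤ : ℕ∞) fun a => k (a - b) :=
    hk.smooth.comp (contDiff_id.sub contDiff_const)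
  have hc : HasCompactSupport fun a => k (a - b) :=
    hk.hasCompactSupport.comp_homeomorph (Homeomorph.subRight b)
  have hi : ∀ V : E3 → E3, Continuous V →
      Integrable fun a => fderiv ℝ (fun a => k (a - b)) a (V a) := fun V hV => by
    refine Continuous.integrable_of_hasCompactSupport
      ((hs.continuous_fderiv (by simp)).clm_apply hV) ?_
    refine (hc.fderiv ℝ).mono fun a ha h => ha ?_
    simp [h]
  have h2 := integral_fderiv_cross3_relV (hs.of_le (by exact_mod_cast le_top)) hc c
  have h3 : ∫ a, fderiv ℝ (fun a => k (a - b)) a (cross3 (relV b) c) = 0 := by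
    simp only [← h1]
    rw [integral_sub_right_eq_self (fun a => fderiv ℝ k a (cross3 (relV b) c)) b,
      hk.integral_fderiv_apply]
  simp only [cross3_sub_left, map_sub, h1]
  have hv : Continuous fun a => cross3 (relV a) c :=
    continuous_cross3.comp (continuous_relV.prodMk continuous_const)
  rw [integral_sub (hi _ hv) (hi _ continuous_const), h2, h3, sub_zero]

/-- The magnetic part of the commutator, whose leading term vanishes since `v × b` is
divergence free. -/
theorem IsKernel.abs_integral_magnetic_le {A r : ℝ} {k : E3 → ℝ} (hk : IsKernel A r k)
    (hr : 0 ≤ r) {P Q : E3 → ℝ} {M C R K N : ℝ} (hP : Measurable P) (hQ : Measurable Q)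
    (hK : 0 ≤ K) (hPM : ∀ a, |P a| ≤ M) (hQC : ∀ a, |Q a| ≤ C) (hQs : ∀ a, R < ‖a‖ → Q a = 0)
    (hPK : ∀ a b, ‖a - b‖ ≤ r → |P a - P b| ≤ K) (c : E3) (hc : ‖c‖ ≤ N) :
    |∫ z : E3 × E3, P z.1 * Q z.2 * fderiv ℝ k (z.1 - z.2) (cross3 (relV z.1 - relV z.2) c)|
      ≤ K * C * (2 * r * N) * (A / r) * volume.real (Metric.closedBall (0 : E3) R) := by
  have hM : 0 ≤ M := (abs_nonneg _).trans (hPM 0)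
  have hC : 0 ≤ C := (abs_nonneg _).trans (hQC 0)
  have hN : 0 ≤ N := (norm_nonneg _).trans hc
  have hcr : Measurable fun z : E3 × E3 => cross3 (relV z.1 - relV z.2) c :=
    ((by fun_prop : Measurable fun z : E3 × E3 => relV z.1).sub (by fun_prop)).cross3
      measurable_const
  have hb : ∀ z : E3 × E3, ‖cross3 (relV z.1 - relV z.2) c‖ ≤ 2 * N := fun z => by
    refine (norm_cross3_le _ _).trans (mul_le_mul ?_ hc (norm_nonneg _) (by norm_num))
    refine (norm_sub_le _ _).trans ?_
    linarith [norm_relV_le z.1, norm_relV_le z.2]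
  have hQ' : ∀ (S : E3 × E3 → ℝ) (z : E3 × E3),
      S z * Q z.2 * fderiv ℝ k (z.1 - z.2) (cross3 (relV z.1 - relV z.2) c)
      = S z * fderiv ℝ k (z.1 - z.2) (Q z.2 • cross3 (relV z.1 - relV z.2) c) := fun S z => by
    rw [map_smul, smul_eq_mul]
    ring
  have hi : ∀ (S : E3 × E3 → ℝ) (D : ℝ), Measurable S → 0 ≤ D → (∀ z, |S z| ≤ D) →
      Integrable fun z : E3 × E3 =>
        S z * Q z.2 * fderiv ℝ k (z.1 - z.2) (cross3 (relV z.1 - relV z.2) c) := by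
    intro S D hS hD hSD
    simp only [hQ']
    refine hk.integrable_mul_fderiv_sub (V := fun z => Q z.2 • cross3 (relV z.1 - relV z.2) c)
      (N := C * (2 * N)) (R := R) hS (by fun_prop) hD hSD (fun z => ?_)
      (fun z hz => by simp [hQs _ hz])
    rw [norm_smul]
    exact mul_le_mul (hQC _) (hb z) (norm_nonneg _) hC
  have i1 := hi (fun z => P z.1 - P z.2) (M + M) (by fun_prop) (by positivity)
    (fun z => (abs_sub _ _).trans (add_le_add (hPM _) (hPM _)))
  have i2 := hi (fun z => P z.2) M (by fun_prop) hM (fun z => hPM _)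
  have e2 : ∫ z : E3 × E3, P z.2 * Q z.2 *
      fderiv ℝ k (z.1 - z.2) (cross3 (relV z.1 - relV z.2) c) = 0 := by
    rw [Measure.volume_eq_prod, integral_prod_symm _ i2]
    refine integral_eq_zero_of_ae (Filter.Eventually.of_forall fun b => ?_)
    simp only [integral_const_mul, Pi.zero_apply]
    rw [hk.integral_fderiv_sub_cross3_relV, mul_zero]
  have e := integral_add i1 i2
  rw [e2, add_zero] at e
  have e' : ∫ z : E3 × E3, P z.1 * Q z.2 *
      fderiv ℝ k (z.1 - z.2) (cross3 (relV z.1 - relV z.2) c)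
      = ∫ z : E3 × E3, (P z.1 - P z.2) *
        fderiv ℝ k (z.1 - z.2) (Q z.2 • cross3 (relV z.1 - relV z.2) c) := by
    rw [← integral_congr_ae (Filter.Eventually.of_forall (hQ' fun z => P z.1 - P z.2)), ← e]
    refine integral_congr_ae (Filter.Eventually.of_forall fun z => ?_)
    ring
  rw [e']
  refine (hk.abs_integral_mul_fderiv_sub_le (U := fun z => P z.1 - P z.2) (R := R)
    (V := fun z => Q z.2 • cross3 (relV z.1 - relV z.2) c) (M := K) (N := C * (2 * r * N))
    hK (by positivity) (fun z hz => hPK _ _ hz) (fun z hz => ?_)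
    (fun z hz _ => by simp [hQs _ hz])).trans_eq (by ring)
  rw [norm_smul]
  refine mul_le_mul (hQC _) ((norm_cross3_le _ _).trans ?_) (norm_nonneg _) hC
  refine mul_le_mul ((norm_relV_sub_le _ _).trans ?_) hc (norm_nonneg _) (by positivity)
  linarith

/-- The data of the doubled equation at a fixed time: the solution `U`, the test function `G`, the
transport derivative `W` of the test function and the fields `E`, `B`, all with constant `Q`. -/
structure IsSlice (α β Q R : ℝ) (U G W : E3 × E3 → ℝ) (E B : E3 → E3) : Prop where
  measurable_U : Measurable U
  measurable_G : Measurable G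
  measurable_W : Measurable W
  measurable_E : Measurable E
  measurable_B : Measurable B
  U_le : ∀ z, |U z| ≤ Q
  G_le : ∀ z, |G z| ≤ Q
  W_le : ∀ z, |W z| ≤ Q
  E_le : ∀ x, ‖E x‖ ≤ Q
  B_le : ∀ x, ‖B x‖ ≤ Q
  U_holder_fst : ∀ x x' ξ, |U (x, ξ) - U (x', ξ)| ≤ Q * ‖x - x'‖ ^ α
  U_holder_snd : ∀ x ξ ξ', |U (x, ξ) - U (x, ξ')| ≤ Q * ‖ξ - ξ'‖ ^ α
  E_holder : ∀ x x', ‖E x - E x'‖ ≤ Q * ‖x - x'‖ ^ β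
  B_holder : ∀ x x', ‖B x - B x'‖ ≤ Q * ‖x - x'‖ ^ β
  G_lipschitz : ∀ z z', |G z - G z'| ≤ Q * ‖z - z'‖
  G_supp : ∀ z, R < ‖z‖ → G z = 0
  W_supp : ∀ z, R < ‖z‖ → W z = 0

theorem integral_prodProdProdComm_swap {X Y : Type*} [MeasureSpace X] [MeasureSpace Y]
    [SFinite (volume : Measure X)] [SFinite (volume : Measure Y)] (g : (Y × Y) × X × X → ℝ) :
    ∫ z : (X × Y) × X × Y, g ((z.1.2, z.2.2), z.1.1, z.2.1) = ∫ z, g z := by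
  have h := integral_prodProdProdComm (α := X) (β := Y) (γ := X) (δ := Y) fun z => g (z.2, z.1)
  rw [h]
  exact integral_prod_swap (μ := (volume : Measure (Y × Y))) (ν := (volume : Measure (X × X))) g

namespace IsSlice

variable {α β Q R A ε δ : ℝ} {U G W : E3 × E3 → ℝ} {E B : E3 → E3} {k₁ k₂ : E3 → ℝ}

theorem nonneg (h : IsSlice α β Q R U G W E B) : 0 ≤ Q := (abs_nonneg _).trans (h.U_le 0)

theorem abs_mollified_sub_le (h : IsSlice α β Q R U G W E B) (hk₁ : IsKernel A ε k₁)
    (hk₂ : IsKernel A δ k₂) (hα : 0 ≤ α) (hε : 0 ≤ ε) (hδ : 0 ≤ δ) :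
    Integrable (fun z : (E3 × E3) × E3 × E3 =>
      U z.1 * (U z.2 * W z.2) * (k₁ (z.1.1 - z.2.1) * k₂ (z.1.2 - z.2.2))) ∧
    |(∫ z : (E3 × E3) × E3 × E3,
        U z.1 * (U z.2 * W z.2) * (k₁ (z.1.1 - z.2.1) * k₂ (z.1.2 - z.2.2)))
      - ∫ z, U z * (U z * W z)|
      ≤ (Q * ε ^ α + Q * δ ^ α) * (Q * Q) * volume.real (Metric.closedBall (0 : E3 × E3) R) := by
  have hQ := h.nonneg
  have hU := h.measurable_U
  have hW := h.measurable_W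
  have hm₁ := hk₁.measurable
  have hm₂ := hk₂.measurable
  obtain ⟨C₁, hC₁, hkC₁⟩ := hk₁.exists_bound
  obtain ⟨C₂, hC₂, hkC₂⟩ := hk₂.exists_bound
  have hsupp : ∀ z : (E3 × E3) × E3 × E3, max ε δ < ‖z.1 - z.2‖ →
      k₁ (z.1.1 - z.2.1) * k₂ (z.1.2 - z.2.2) = 0 := fun z hz => by
    rcases lt_max_iff.1 (show max ε δ < max ‖z.1.1 - z.2.1‖ ‖z.1.2 - z.2.2‖ from hz) with hz | hz
    · rw [hk₁.supp _ ((le_max_left _ _).trans_lt hz), zero_mul]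
    · rw [hk₂.supp _ ((le_max_right _ _).trans_lt hz), mul_zero]
  have hi : ∀ S : (E3 × E3) × E3 × E3 → ℝ, Measurable S → (∃ D, ∀ z, |S z| ≤ D) →
      Integrable fun z : (E3 × E3) × E3 × E3 =>
        S z * (U z.2 * W z.2) * (k₁ (z.1.1 - z.2.1) * k₂ (z.1.2 - z.2.2)) := by
    rintro S hS ⟨D, hD⟩
    have hD0 : 0 ≤ D := (abs_nonneg _).trans (hD 0)
    refine integrable_of_bounded_of_sub_support (by fun_prop) (C := D * (Q * Q) * (C₁ * C₂))
      (R := R) (r := max ε δ) (fun z => ?_) (fun z hz => by simp [h.W_supp _ hz])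
      (fun z hz => by rw [hsupp z hz, mul_zero])
    have h1 := hD z
    have h2 := h.U_le z.2
    have h3 := h.W_le z.2
    have h4 := hkC₁ (z.1.1 - z.2.1)
    have h5 := hkC₂ (z.1.2 - z.2.2)
    simp only [abs_mul]
    gcongr
  have i1 := hi (fun z => U z.1) (by fun_prop) ⟨Q, fun z => h.U_le _⟩
  have i2 := hi (fun z => U z.2) (by fun_prop) ⟨Q, fun z => h.U_le _⟩
  refine ⟨i1, ?_⟩
  have hk : Integrable fun q : E3 × E3 => k₁ q.1 * k₂ q.2 :=
    (hk₁.smooth.continuous.integrable_of_hasCompactSupport hk₁.hasCompactSupport).mul_prod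
      (hk₂.smooth.continuous.integrable_of_hasCompactSupport hk₂.hasCompactSupport)
  have hk1 : ∫ q : E3 × E3, k₁ q.1 * k₂ q.2 = 1 := by
    have := integral_prod_mul (μ := (volume : Measure E3)) (ν := (volume : Measure E3)) k₁ k₂
    rw [hk₁.integral_eq, hk₂.integral_eq, mul_one] at this
    exact this
  have e2 : ∫ z : (E3 × E3) × E3 × E3,
      U z.2 * (U z.2 * W z.2) * (k₁ (z.1.1 - z.2.1) * k₂ (z.1.2 - z.2.2))
      = ∫ z, U z * (U z * W z) := by
    refine (integral_prod_symm _ i2).trans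
      (integral_congr_ae (Filter.Eventually.of_forall fun z => ?_))
    simp only [integral_const_mul]
    rw [show (∫ x : E3 × E3, k₁ (x.1 - z.1) * k₂ (x.2 - z.2)) = 1 from
      (integral_sub_right_eq_self (fun q : E3 × E3 => k₁ q.1 * k₂ q.2) z).trans hk1, mul_one]
  rw [← e2, ← integral_sub i1 i2]
  refine (abs_integral_le_of_abs_le_comp_sub (Y := E3 × E3)
    (c := (Q * ε ^ α + Q * δ ^ α) * (Q * Q)) (R := R) (by positivity) hk
    (fun q => mul_nonneg (hk₁.nonneg _) (hk₂.nonneg _)) (fun z => ?_)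
    (fun z hz => by simp [h.W_supp _ hz])).trans_eq (by rw [hk1, mul_one])
  rcases lt_or_ge ε ‖z.1.1 - z.2.1‖ with hz1 | hz1
  · simp [hk₁.supp _ hz1]
  rcases lt_or_ge δ ‖z.1.2 - z.2.2‖ with hz2 | hz2
  · simp [hk₂.supp _ hz2]
  rw [← sub_mul, ← sub_mul, abs_mul, abs_mul, abs_mul (U z.2),
    abs_of_nonneg (mul_nonneg (hk₁.nonneg (z.1.1 - z.2.1)) (hk₂.nonneg (z.1.2 - z.2.2)))]
  refine mul_le_mul_of_nonneg_right ?_ (mul_nonneg (hk₁.nonneg _) (hk₂.nonneg _))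
  refine mul_le_mul ?_ (mul_le_mul (h.U_le _) (h.W_le _) (abs_nonneg _) hQ) (by positivity)
    (by positivity)
  have e : U z.1 - U z.2 = (U (z.1.1, z.1.2) - U (z.2.1, z.1.2))
      + (U (z.2.1, z.1.2) - U (z.2.1, z.2.2)) := by ring
  rw [e]
  refine (abs_add_le _ _).trans (add_le_add ((h.U_holder_fst _ _ _).trans ?_)
    ((h.U_holder_snd _ _ _).trans ?_))
  · gcongr
  · gcongr

theorem abs_transport_le (h : IsSlice α β Q R U G W E B) (hk₁ : IsKernel A ε k₁)
    (hk₂ : IsKernel A δ k₂) (hA : 0 ≤ A) (hα : 0 ≤ α) (hε : 0 ≤ ε) (hε1 : ε ≤ 1) (hδ : 0 ≤ δ) :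
    |∫ z : (E3 × E3) × E3 × E3, U z.1 * U z.2 *
        (fderiv ℝ k₁ (z.1.1 - z.2.1) (G z.2 • (relV z.1.2 - relV z.2.2)) * k₂ (z.1.2 - z.2.2))|
      ≤ (Q * ε ^ α * (Q * δ ^ α) * (Q * (2 * δ)) + Q ^ 2 * (Q * (2 * δ) * ε)) * (A / ε)
        * volume.real (Metric.closedBall (0 : E3) (R + 1))
        * volume.real (Metric.closedBall (0 : E3) R) := by
  have hQ := h.nonneg
  have hG := h.measurable_G
  rw [integral_prodProdProdComm (α := E3) (β := E3) (γ := E3) (δ := E3) fun z =>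
    U (z.1.1, z.2.1) * U (z.1.2, z.2.2) *
      (fderiv ℝ k₁ (z.1.1 - z.1.2) (G (z.1.2, z.2.2) • (relV z.2.1 - relV z.2.2)) *
        k₂ (z.2.1 - z.2.2))]
  have hv : ∀ y : E3 × E3, ‖y.1 - y.2‖ ≤ δ → ‖relV y.1 - relV y.2‖ ≤ 2 * δ := fun y hy =>
    (norm_relV_sub_le _ _).trans (by linarith)
  refine hk₁.abs_integral_commutator_prod_le hk₂ hA hε hε1
    (V := fun y a => G (a, y.2) • (relV y.1 - relV y.2)) h.measurable_U
    (fun y => by fun_prop) (by positivity) (by positivity) (by positivity) h.U_le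
    (fun a b y hab => (h.U_holder_fst _ _ _).trans (by gcongr))
    (fun a y y' hy => (h.U_holder_snd _ _ _).trans (by gcongr))
    (fun y a hy => ?_) (fun y a b hy => ?_) (fun y a ha => ?_) (fun y a ha => ?_)
  · rw [norm_smul]
    exact mul_le_mul (h.G_le _) (hv y hy) (norm_nonneg _) hQ
  · rw [← sub_smul, norm_smul]
    have h1 := h.G_lipschitz (a, y.2) (b, y.2)
    have h2 : ‖((a, y.2) : E3 × E3) - (b, y.2)‖ = ‖a - b‖ := by simp [Prod.norm_def]
    rw [h2] at h1
    refine (mul_le_mul h1 (hv y hy) (norm_nonneg _) (by positivity)).trans_eq (by ring)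
  · simp [h.G_supp (a, y.2) (ha.trans_le (le_max_left _ _))]
  · simp [h.G_supp (a, y.2) (ha.trans_le (le_max_right _ _))]

theorem abs_force_le (h : IsSlice α β Q R U G W E B) (hk₁ : IsKernel A ε k₁)
    (hk₂ : IsKernel A δ k₂) (hA : 0 ≤ A) (hα : 0 ≤ α) (hβ : 0 ≤ β) (hε : 0 ≤ ε) (hδ : 0 ≤ δ)
    (hδ1 : δ ≤ 1) :
    |∫ z : (E3 × E3) × E3 × E3, U z.1 * U z.2 *
        (fderiv ℝ k₂ (z.1.2 - z.2.2)
          (G z.2 • (E z.1.1 - E z.2.1 + cross3 (relV z.2.2) (B z.1.1 - B z.2.1)))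
          * k₁ (z.1.1 - z.2.1))|
      ≤ (Q * δ ^ α * (Q * ε ^ α) * (4 * Q ^ 2 * ε ^ β) + Q ^ 2 * (4 * Q ^ 2 * ε ^ β * δ)) * (A / δ)
        * volume.real (Metric.closedBall (0 : E3) (R + 1))
        * volume.real (Metric.closedBall (0 : E3) R) := by
  have hQ := h.nonneg
  have hG := h.measurable_G
  have hU := h.measurable_U
  rw [integral_prodProdProdComm_swap (X := E3) (Y := E3) fun z =>
    U (z.2.1, z.1.1) * U (z.2.2, z.1.2) *
      (fderiv ℝ k₂ (z.1.1 - z.1.2) (G (z.2.2, z.1.2) •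
        (E z.2.1 - E z.2.2 + cross3 (relV z.1.2) (B z.2.1 - B z.2.2))) * k₁ (z.2.1 - z.2.2))]
  have hE : ∀ y : E3 × E3, ‖y.1 - y.2‖ ≤ ε → ‖E y.1 - E y.2‖ ≤ Q * ε ^ β := fun y hy =>
    (h.E_holder _ _).trans (by gcongr)
  have hB : ∀ y : E3 × E3, ‖y.1 - y.2‖ ≤ ε → ‖B y.1 - B y.2‖ ≤ Q * ε ^ β := fun y hy =>
    (h.B_holder _ _).trans (by gcongr)
  have hF : ∀ (y : E3 × E3) (a : E3), ‖y.1 - y.2‖ ≤ ε →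
      ‖E y.1 - E y.2 + cross3 (relV a) (B y.1 - B y.2)‖ ≤ 2 * (Q * ε ^ β) := fun y a hy => by
    have h1 := mul_le_mul (norm_relV_le a) (hB y hy) (norm_nonneg _) zero_le_one
    linarith [norm_add_le (E y.1 - E y.2) (cross3 (relV a) (B y.1 - B y.2)), hE y hy,
      norm_cross3_le (relV a) (B y.1 - B y.2)]
  refine hk₂.abs_integral_commutator_prod_le hk₁ hA hδ hδ1 (P := fun z => U (z.2, z.1))
    (V := fun y a => G (y.2, a) • (E y.1 - E y.2 + cross3 (relV a) (B y.1 - B y.2)))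
    (by fun_prop) (fun y => ?_) (by positivity) (by positivity) (by positivity)
    (fun z => h.U_le _)
    (fun a b y hab => (h.U_holder_snd _ _ _).trans (by gcongr))
    (fun a y y' hy => (h.U_holder_fst _ _ _).trans (by gcongr))
    (fun y a hy => ?_) (fun y a b hy => ?_) (fun y a ha => ?_) (fun y a ha => ?_)
  · have : Measurable fun a => cross3 (relV a) (B y.1 - B y.2) :=
      (by fun_prop : Measurable relV).cross3 measurable_const
    fun_prop
  · rw [norm_smul]
    refine (mul_le_mul (h.G_le _) (hF y a hy) (norm_nonneg _) hQ).trans ?_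
    have : 0 ≤ Q ^ 2 * ε ^ β := by positivity
    nlinarith
  · have h1 := h.G_lipschitz (y.2, a) (y.2, b)
    have h2 : ‖((y.2, a) : E3 × E3) - (y.2, b)‖ = ‖a - b‖ := by simp [Prod.norm_def]
    rw [h2] at h1
    have e : G (y.2, a) • (E y.1 - E y.2 + cross3 (relV a) (B y.1 - B y.2))
        - G (y.2, b) • (E y.1 - E y.2 + cross3 (relV b) (B y.1 - B y.2))
        = (G (y.2, a) - G (y.2, b)) • (E y.1 - E y.2 + cross3 (relV a) (B y.1 - B y.2))
          + G (y.2, b) • cross3 (relV a - relV b) (B y.1 - B y.2) := by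
      rw [cross3_sub_left]
      module
    rw [e]
    refine (norm_add_le _ _).trans ?_
    rw [norm_smul, norm_smul]
    have h3 := mul_le_mul h1 (hF y a hy) (norm_nonneg _) (by positivity)
    have h4 := (norm_cross3_le (relV a - relV b) (B y.1 - B y.2)).trans
      (mul_le_mul (norm_relV_sub_le a b) (hB y hy) (norm_nonneg _) (by positivity))
    have h5 := mul_le_mul (h.G_le (y.2, b)) h4 (norm_nonneg _) hQ
    refine (add_le_add h3 h5).trans_eq (by ring)
  · simp [h.G_supp (y.2, a) (ha.trans_le (le_max_right _ _))]
  · simp [h.G_supp (y.2, a) (ha.trans_le (le_max_left _ _))]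

theorem abs_magnetic_le (h : IsSlice α β Q R U G W E B) (hk₁ : IsKernel A ε k₁)
    (hk₂ : IsKernel A δ k₂) (hA : 0 ≤ A) (hα : 0 ≤ α) (hδ : 0 ≤ δ) :
    |∫ z : (E3 × E3) × E3 × E3, U z.1 * (U z.2 * G z.2) *
        fderiv ℝ k₂ (z.1.2 - z.2.2) (cross3 (relV z.1.2 - relV z.2.2) (B z.1.1))
          * k₁ (z.1.1 - z.2.1)|
      ≤ Q * δ ^ α * (Q * Q) * (2 * δ * Q) * (A / δ) * volume.real (Metric.closedBall (0 : E3) R)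
        * volume.real (Metric.closedBall (0 : E3) R) := by
  have hQ := h.nonneg
  have hG := h.measurable_G
  have hU := h.measurable_U
  rw [integral_prodProdProdComm_swap (X := E3) (Y := E3) fun z =>
    U (z.2.1, z.1.1) * (U (z.2.2, z.1.2) * G (z.2.2, z.1.2)) *
      fderiv ℝ k₂ (z.1.1 - z.1.2) (cross3 (relV z.1.1 - relV z.1.2) (B z.2.1)) *
        k₁ (z.2.1 - z.2.2)]
  refine hk₁.abs_integral_le_of_abs_inner_le (by positivity) (fun y => ?_) (fun z y hy => ?_)
  · dsimp only
    rw [integral_mul_const, abs_mul, abs_of_nonneg (hk₁.nonneg _)]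
    refine mul_le_mul_of_nonneg_right ?_ (hk₁.nonneg _)
    refine hk₂.abs_integral_magnetic_le hδ (P := fun a => U (y.1, a))
      (Q := fun a => U (y.2, a) * G (y.2, a)) (by fun_prop) (by fun_prop) (by positivity)
      (fun a => h.U_le _) (fun a => ?_) (fun a ha => ?_)
      (fun a b hab => (h.U_holder_snd _ _ _).trans (by gcongr)) _ (h.B_le _)
    · rw [abs_mul]
      exact mul_le_mul (h.U_le _) (h.G_le _) (abs_nonneg _) hQ
    · simp [h.G_supp (y.2, a) (ha.trans_le (le_max_right _ _))]
  · simp [h.G_supp (y.2, z.2) (hy.trans_le (le_max_left _ _))]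

end IsSlice

theorem integrable_mul_clm_apply_mul {X F : Type*} [NormedAddCommGroup X] [ProperSpace X]
    [MeasurableSpace X] {μ : Measure (X × X)} [IsFiniteMeasureOnCompacts μ]
    [NormedAddCommGroup F] [NormedSpace ℝ F] [MeasurableSpace F] [BorelSpace F]
    [SecondCountableTopology F] [SecondCountableTopology (F →L[ℝ] ℝ)]
    {S κ : X × X → ℝ} {ℓ : X × X → F →L[ℝ] ℝ} {V : X × X → F} {C₁ C₂ C₃ C₄ R r : ℝ}
    (hS : Measurable S) (hκ : Measurable κ) (hℓ : Measurable ℓ) (hV : Measurable V)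
    (hSC : ∀ z, |S z| ≤ C₁) (hℓC : ∀ z, ‖ℓ z‖ ≤ C₂) (hVC : ∀ z, ‖V z‖ ≤ C₃)
    (hκC : ∀ z, |κ z| ≤ C₄) (hs : ∀ z, R < ‖z.2‖ → S z * ℓ z (V z) = 0)
    (hs' : ∀ z, r < ‖z.1 - z.2‖ → ℓ z = 0 ∨ κ z = 0) :
    Integrable (fun z => S z * (ℓ z (V z) * κ z)) μ := by
  refine integrable_of_bounded_of_sub_support (by fun_prop) (C := C₁ * (C₂ * C₃ * C₄)) (R := R)
    (r := r) (fun z => ?_) (fun z hz => by rw [← mul_assoc, hs z hz, zero_mul]) (fun z hz => ?_)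
  · have h1 := hSC z
    have h2 := ((ℓ z).le_opNorm (V z)).trans
      (mul_le_mul (hℓC z) (hVC z) (norm_nonneg _) ((norm_nonneg _).trans (hℓC z)))
    have h3 := hκC z
    have h4 := (abs_nonneg _).trans h1
    have h5 := (norm_nonneg _).trans h2
    rw [Real.norm_eq_abs] at h2
    simp only [abs_mul]
    gcongr
  · rcases hs' z hz with h | h <;> simp [h]

namespace IsSlice

variable {α β Q R A ε δ : ℝ} {U G W : E3 × E3 → ℝ} {E B : E3 → E3} {k₁ k₂ : E3 → ℝ}

/-- At a fixed time, the doubled equation is close to the equation for `U ^ 2`. -/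
theorem abs_doubling_sub_le (h : IsSlice α β Q R U G W E B) (hk₁ : IsKernel A ε k₁)
    (hk₂ : IsKernel A δ k₂) (hA : 0 ≤ A) (hα : 0 ≤ α) (hβ : 0 ≤ β) (hε : 0 ≤ ε) (hε1 : ε ≤ 1)
    (hδ : 0 ≤ δ) (hδ1 : δ ≤ 1) :
    |(∫ z : (E3 × E3) × E3 × E3, U z.1 * U z.2 * (W z.2 * (k₁ (z.1 - z.2).1 * k₂ (z.1 - z.2).2)
        + G z.2 * fderiv ℝ (fun q : E3 × E3 => k₁ q.1 * k₂ q.2) (z.1 - z.2)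
          ((relV z.1.2, E z.1.1 + cross3 (relV z.1.2) (B z.1.1))
            - (relV z.2.2, E z.2.1 + cross3 (relV z.2.2) (B z.2.1)))))
      - ∫ z, U z * (U z * W z)|
    ≤ (Q * ε ^ α + Q * δ ^ α) * (Q * Q) * volume.real (Metric.closedBall (0 : E3 × E3) R)
      + (Q * ε ^ α * (Q * δ ^ α) * (Q * (2 * δ)) + Q ^ 2 * (Q * (2 * δ) * ε)) * (A / ε)
        * volume.real (Metric.closedBall (0 : E3) (R + 1))
        * volume.real (Metric.closedBall (0 : E3) R)
      + (Q * δ ^ α * (Q * ε ^ α) * (4 * Q ^ 2 * ε ^ β) + Q ^ 2 * (4 * Q ^ 2 * ε ^ β * δ)) * (A / δ)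
        * volume.real (Metric.closedBall (0 : E3) (R + 1))
        * volume.real (Metric.closedBall (0 : E3) R)
      + Q * δ ^ α * (Q * Q) * (2 * δ * Q) * (A / δ) * volume.real (Metric.closedBall (0 : E3) R)
        * volume.real (Metric.closedBall (0 : E3) R) := by
  have hQ := h.nonneg
  have hU := h.measurable_U
  have hG := h.measurable_G
  have hE := h.measurable_E
  have hB := h.measurable_B
  have hm₁ := hk₁.measurable
  have hm₂ := hk₂.measurable
  have hd₁ := hk₁.measurable_fderiv
  have hd₂ := hk₂.measurable_fderiv
  obtain ⟨C₁, hC₁, hkC₁⟩ := hk₁.exists_bound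
  obtain ⟨C₂, hC₂, hkC₂⟩ := hk₂.exists_bound
  obtain ⟨D₁, hD₁, hkD₁⟩ := hk₁.exists_fderiv_bound
  obtain ⟨D₂, hD₂, hkD₂⟩ := hk₂.exists_fderiv_bound
  obtain ⟨i0, b0⟩ := h.abs_mollified_sub_le hk₁ hk₂ hα hε hδ
  have b1 := h.abs_transport_le hk₁ hk₂ hA hα hε hε1 hδ
  have b2 := h.abs_force_le hk₁ hk₂ hA hα hβ hε hδ hδ1
  have b3 := h.abs_magnetic_le hk₁ hk₂ hA hα hδ
  have hsub : ∀ z : (E3 × E3) × E3 × E3, max ε δ < ‖z.1 - z.2‖ →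
      ε < ‖z.1.1 - z.2.1‖ ∨ δ < ‖z.1.2 - z.2.2‖ := fun z hz => by
    rcases lt_max_iff.1 (show max ε δ < max ‖z.1.1 - z.2.1‖ ‖z.1.2 - z.2.2‖ from hz) with hz | hz
    · exact Or.inl ((le_max_left _ _).trans_lt hz)
    · exact Or.inr ((le_max_right _ _).trans_lt hz)
  have hUU : ∀ z : (E3 × E3) × E3 × E3, |U z.1 * U z.2| ≤ Q * Q := fun z => by
    rw [abs_mul]
    exact mul_le_mul (h.U_le _) (h.U_le _) (abs_nonneg _) hQ
  have hvd : ∀ z : (E3 × E3) × E3 × E3, ‖relV z.1.2 - relV z.2.2‖ ≤ 2 := fun z => by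
    linarith [norm_sub_le (relV z.1.2) (relV z.2.2), norm_relV_le z.1.2, norm_relV_le z.2.2]
  have hc1 : Measurable fun z : (E3 × E3) × E3 × E3 =>
      cross3 (relV z.2.2) (B z.1.1 - B z.2.1) :=
    (by fun_prop : Measurable fun z : (E3 × E3) × E3 × E3 => relV z.2.2).cross3 (by fun_prop)
  have hc2 : Measurable fun z : (E3 × E3) × E3 × E3 =>
      cross3 (relV z.1.2 - relV z.2.2) (B z.1.1) :=
    (by fun_prop : Measurable fun z : (E3 × E3) × E3 × E3 => relV z.1.2 - relV z.2.2).cross3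
      (by fun_prop)
  have i1 : Integrable fun z : (E3 × E3) × E3 × E3 => U z.1 * U z.2 *
      (fderiv ℝ k₁ (z.1.1 - z.2.1) (G z.2 • (relV z.1.2 - relV z.2.2)) * k₂ (z.1.2 - z.2.2)) := by
    refine integrable_mul_clm_apply_mul (S := fun z : (E3 × E3) × E3 × E3 => U z.1 * U z.2)
      (κ := fun z => k₂ (z.1.2 - z.2.2)) (ℓ := fun z => fderiv ℝ k₁ (z.1.1 - z.2.1))
      (V := fun z => G z.2 • (relV z.1.2 - relV z.2.2)) (C₃ := Q * 2) (R := R) (r := max ε δ)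
      (by fun_prop) (by fun_prop) (by fun_prop) (by fun_prop) hUU (fun z => hkD₁ _) (fun z => ?_)
      (fun z => hkC₂ _) (fun z hz => by simp [h.G_supp _ hz])
      (fun z hz => (hsub z hz).imp hk₁.fderiv_supp (hk₂.supp _))
    rw [norm_smul]
    exact mul_le_mul (h.G_le _) (hvd z) (norm_nonneg _) hQ
  have i2 : Integrable fun z : (E3 × E3) × E3 × E3 => U z.1 * U z.2 *
        (fderiv ℝ k₂ (z.1.2 - z.2.2)
          (G z.2 • (E z.1.1 - E z.2.1 + cross3 (relV z.2.2) (B z.1.1 - B z.2.1)))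
          * k₁ (z.1.1 - z.2.1)) := by
    refine integrable_mul_clm_apply_mul (S := fun z : (E3 × E3) × E3 × E3 => U z.1 * U z.2)
      (κ := fun z => k₁ (z.1.1 - z.2.1)) (ℓ := fun z => fderiv ℝ k₂ (z.1.2 - z.2.2))
      (V := fun z => G z.2 • (E z.1.1 - E z.2.1 + cross3 (relV z.2.2) (B z.1.1 - B z.2.1)))
      (C₃ := Q * (2 * Q + 1 * (2 * Q))) (R := R) (r := max ε δ)
      (by fun_prop) (by fun_prop) (by fun_prop) (by fun_prop) hUU (fun z => hkD₂ _) (fun z => ?_)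
      (fun z => hkC₁ _) (fun z hz => by simp [h.G_supp _ hz])
      (fun z hz => ((hsub z hz).imp (hk₁.supp _) hk₂.fderiv_supp).symm)
    rw [norm_smul]
    refine mul_le_mul (h.G_le _) ((norm_add_le _ _).trans (add_le_add ?_
      ((norm_cross3_le _ _).trans (mul_le_mul (norm_relV_le _) ?_ (norm_nonneg _) zero_le_one))))
      (norm_nonneg _) hQ
    · linarith [norm_sub_le (E z.1.1) (E z.2.1), h.E_le z.1.1, h.E_le z.2.1]
    · linarith [norm_sub_le (B z.1.1) (B z.2.1), h.B_le z.1.1, h.B_le z.2.1]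
  have i3 : Integrable fun z : (E3 × E3) × E3 × E3 => U z.1 * (U z.2 * G z.2) *
        fderiv ℝ k₂ (z.1.2 - z.2.2) (cross3 (relV z.1.2 - relV z.2.2) (B z.1.1))
          * k₁ (z.1.1 - z.2.1) := by
    simp only [mul_assoc (_ * (_ * _))]
    refine integrable_mul_clm_apply_mul
      (S := fun z : (E3 × E3) × E3 × E3 => U z.1 * (U z.2 * G z.2))
      (κ := fun z => k₁ (z.1.1 - z.2.1)) (ℓ := fun z => fderiv ℝ k₂ (z.1.2 - z.2.2))
      (V := fun z => cross3 (relV z.1.2 - relV z.2.2) (B z.1.1)) (C₁ := Q * (Q * Q))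
      (C₃ := 2 * Q) (R := R) (r := max ε δ)
      (by fun_prop) (by fun_prop) (by fun_prop) (by fun_prop) (fun z => ?_) (fun z => hkD₂ _)
      (fun z => ?_) (fun z => hkC₁ _) (fun z hz => by simp [h.G_supp _ hz])
      (fun z hz => ((hsub z hz).imp (hk₁.supp _) hk₂.fderiv_supp).symm)
    · rw [abs_mul, abs_mul]
      exact mul_le_mul (h.U_le _) (mul_le_mul (h.U_le _) (h.G_le _) (abs_nonneg _) hQ)
        (by positivity) hQ
    · exact (norm_cross3_le _ _).trans
        (mul_le_mul (hvd z) (h.B_le _) (norm_nonneg _) (by norm_num))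
  have e01 := integral_add i0 i1
  have e012 := integral_add (i0.add i1) i2
  have e := integral_add ((i0.add i1).add i2) i3
  simp only [Pi.add_apply] at e012 e
  rw [e012, e01] at e
  have key : ∀ z : (E3 × E3) × E3 × E3,
      U z.1 * U z.2 * (W z.2 * (k₁ (z.1 - z.2).1 * k₂ (z.1 - z.2).2)
        + G z.2 * fderiv ℝ (fun q : E3 × E3 => k₁ q.1 * k₂ q.2) (z.1 - z.2)
          ((relV z.1.2, E z.1.1 + cross3 (relV z.1.2) (B z.1.1))
            - (relV z.2.2, E z.2.1 + cross3 (relV z.2.2) (B z.2.1))))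
      = U z.1 * (U z.2 * W z.2) * (k₁ (z.1.1 - z.2.1) * k₂ (z.1.2 - z.2.2))
        + U z.1 * U z.2 * (fderiv ℝ k₁ (z.1.1 - z.2.1) (G z.2 • (relV z.1.2 - relV z.2.2))
          * k₂ (z.1.2 - z.2.2))
        + U z.1 * U z.2 * (fderiv ℝ k₂ (z.1.2 - z.2.2)
          (G z.2 • (E z.1.1 - E z.2.1 + cross3 (relV z.2.2) (B z.1.1 - B z.2.1)))
            * k₁ (z.1.1 - z.2.1))
        + U z.1 * (U z.2 * G z.2) *
          fderiv ℝ k₂ (z.1.2 - z.2.2) (cross3 (relV z.1.2 - relV z.2.2) (B z.1.1))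
            * k₁ (z.1.1 - z.2.1) := fun z => by
    rw [fderiv_mul_prod (hk₁.smooth.differentiable (by simp)) (hk₂.smooth.differentiable (by simp))]
    simp only [Prod.fst_sub, Prod.snd_sub, Prod.mk_sub_mk, cross3_sub_left, cross3_sub_right,
      map_smul, map_sub, map_add, smul_eq_mul]
    ring
  rw [integral_congr_ae (Filter.Eventually.of_forall key), e]
  rw [abs_le] at *
  constructor <;> linarith [b0.1, b0.2, b1.1, b1.2, b2.1, b2.2, b3.1, b3.2]

end IsSlice

theorem tendsto_rpow_nhdsGT_zero {s : ℝ} (hs : 0 < s) :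
    Filter.Tendsto (fun ε : ℝ => ε ^ s) (nhdsWithin 0 (Ioi 0)) (nhds 0) := by
  have h := (Real.continuousAt_rpow_const 0 s (Or.inr hs.le)).tendsto
  rw [Real.zero_rpow hs.ne'] at h
  exact h.mono_left nhdsWithin_le_nhds

/-- Under the Onsager-type condition the scales in space and momentum can be chosen so that the
commutator errors vanish. -/
theorem exists_scales {α β : ℝ} (hα : 0 < α) (hα1 : α < 1) (hβ : 0 < β)
    (hO : α * β + β + 3 * α - 1 > 0) (c₁ c₂ c₃ c₄ c₅ c₆ : ℝ) {η : ℝ} (hη : 0 < η) :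
    ∃ ε δ : ℝ, 0 < ε ∧ ε ≤ 1 ∧ 0 < δ ∧ δ ≤ 1 ∧
      c₁ * ε ^ α + c₂ * δ ^ α + c₃ * δ + c₄ * ε ^ β + c₅ * (ε ^ α * δ ^ α * δ / ε)
        + c₆ * (δ ^ α * ε ^ α * ε ^ β / δ) < η := by
  have hlt : (1 - α) / (1 + α) < (α + β) / (1 - α) := by
    rw [div_lt_div_iff₀ (by linarith) (by linarith)]
    nlinarith
  obtain ⟨a, ha1, ha2⟩ := exists_between hlt
  have ha : 0 < a := (div_pos (by linarith) (by linarith)).trans ha1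
  rw [div_lt_iff₀ (by linarith)] at ha1
  rw [lt_div_iff₀ (by linarith)] at ha2
  have t1 := tendsto_rpow_nhdsGT_zero hα
  have t2 := tendsto_rpow_nhdsGT_zero (mul_pos ha hα)
  have t3 := tendsto_rpow_nhdsGT_zero ha
  have t4 := tendsto_rpow_nhdsGT_zero hβ
  have t5 := tendsto_rpow_nhdsGT_zero (s := α + a * α + a - 1) (by linarith)
  have t6 := tendsto_rpow_nhdsGT_zero (s := a * α + α + β - a) (by linarith)
  have t := (((((t1.const_mul c₁).add (t2.const_mul c₂)).add (t3.const_mul c₃)).add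
    (t4.const_mul c₄)).add (t5.const_mul c₅)).add (t6.const_mul c₆)
  simp only [mul_zero, add_zero] at t
  have h1 : ∀ᶠ ε : ℝ in nhdsWithin 0 (Ioi 0), ε ≤ 1 :=
    (eventually_le_nhds one_pos).filter_mono nhdsWithin_le_nhds
  obtain ⟨ε, hlt, hε1, hε⟩ :=
    ((t.eventually (gt_mem_nhds hη)).and (h1.and self_mem_nhdsWithin)).exists
  have hε0 : 0 < ε := hε
  refine ⟨ε, ε ^ a, hε0, hε1, Real.rpow_pos_of_pos hε0 _, Real.rpow_le_one hε0.le hε1 ha.le, ?_⟩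
  rw [← Real.rpow_mul hε0.le, ← Real.rpow_add hε0, ← Real.rpow_add hε0, ← Real.rpow_add hε0,
    ← Real.rpow_add hε0, ← Real.rpow_sub_one hε0.ne', ← Real.rpow_sub hε0]
  exact hlt

/-- Bounded functions that are Hölder continuous in space and momentum, uniformly in time. -/
structure HolderBdd (T α : ℝ) (u : Phase → ℝ) : Prop extends MeasBdd u where
  holder : ∃ K, 0 ≤ K ∧ ∀ t ∈ Ioo 0 T,
    (∀ x x' ξ, |u (t, x, ξ) - u (t, x', ξ)| ≤ K * ‖x - x'‖ ^ α) ∧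
    ∀ x ξ ξ', |u (t, x, ξ) - u (t, x, ξ')| ≤ K * ‖ξ - ξ'‖ ^ α

/-- Bounded vector fields that are Hölder continuous in space, uniformly in time. -/
structure HolderField (T β : ℝ) (E : ℝ → E3 → E3) : Prop extends
    MeasBdd fun p : ℝ × E3 => E p.1 p.2 where
  holder : ∃ L, 0 ≤ L ∧ ∀ t ∈ Ioo 0 T, ∀ x x', ‖E t x - E t x'‖ ≤ L * ‖x - x'‖ ^ β

theorem exists_isSlice {T α β : ℝ} {u Ψ : Phase → ℝ} {E B : ℝ → E3 → E3} (hu : HolderBdd T α u)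
    (hE : HolderField T β E) (hB : HolderField T β B) (hΨ : IsTest T Ψ) :
    ∃ Q R, 0 ≤ Q ∧ (∀ p, R < ‖p‖ → Ψ p = 0 ∧ fderiv ℝ Ψ p = 0) ∧
      (∀ p, |Ψ p| ≤ Q) ∧ (∀ p, ‖fderiv ℝ Ψ p‖ ≤ Q) ∧ (∀ p, |u p| ≤ Q) ∧
      (∀ p, ‖vlasovField E B p‖ ≤ Q) ∧
      ∀ t ∈ Ioo 0 T, IsSlice α β Q R (fun z => u (t, z)) (fun z => Ψ (t, z))
      (fun z => fderiv ℝ Ψ (t, z) (1, vlasovField E B (t, z))) (E t) (B t) := by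
  obtain ⟨M, hM, huM⟩ := hu.exists_nonneg_bound
  obtain ⟨K, hK, huK⟩ := hu.holder
  obtain ⟨M₁, hM₁, hEM⟩ := hE.exists_nonneg_bound
  obtain ⟨L₁, hL₁, hEL⟩ := hE.holder
  obtain ⟨M₂, hM₂, hBM⟩ := hB.exists_nonneg_bound
  obtain ⟨L₂, hL₂, hBL⟩ := hB.holder
  have hA := measBdd_vlasovField hE.toMeasBdd hB.toMeasBdd
  obtain ⟨N, hN, hAN⟩ := hA.exists_nonneg_bound
  obtain ⟨C, R, hC, -, hΨC, hΨC', hΨR, hΨR'⟩ := hΨ.exists_bound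
  have hCN : 0 ≤ C * (1 + N) := by positivity
  let Q := M + K + M₁ + L₁ + M₂ + L₂ + N + C + C * (1 + N)
  have hCQ : C ≤ Q := by dsimp only [Q]; linarith
  have hR : ∀ (t : ℝ) (z : E3 × E3), R < ‖z‖ → R < ‖((t, z) : Phase)‖ := fun t z hz =>
    hz.trans_le (le_max_right _ _)
  have hum := hu.measurable
  have hAm := hA.measurable
  have hΨm := hΨ.smooth.continuous.measurable
  have hΨm' := hΨ.continuous_fderiv.measurable
  have hEm := hE.measurable
  have hBm := hB.measurable
  refine ⟨Q, R, by positivity, fun p hp => ⟨hΨR p hp, hΨR' p hp⟩, fun p => (hΨC p).trans hCQ,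
    fun p => (hΨC' p).trans hCQ, fun p => (huM p).trans (by dsimp only [Q]; linarith),
    fun p => (hAN p).trans (by dsimp only [Q]; linarith), fun t ht => ?_⟩
  exact
  { measurable_U := by fun_prop
    measurable_G := by fun_prop
    measurable_W := by fun_prop
    measurable_E := hEm.comp (measurable_const.prodMk measurable_id)
    measurable_B := hBm.comp (measurable_const.prodMk measurable_id)
    U_le := fun z => (huM _).trans (by dsimp only [Q]; linarith)
    G_le := fun z => (hΨC _).trans hCQ
    W_le := fun z => by
      refine ((fderiv ℝ Ψ (t, z)).le_opNorm _).trans ((mul_le_mul (hΨC' _)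
        (?_ : _ ≤ 1 + N) (norm_nonneg _) hC).trans (by dsimp only [Q]; linarith))
      refine max_le ?_ ((hAN _).trans (by linarith))
      simp only [norm_one]
      linarith
    E_le := fun x => (hEM (t, x)).trans (by dsimp only [Q]; linarith)
    B_le := fun x => (hBM (t, x)).trans (by dsimp only [Q]; linarith)
    U_holder_fst := fun x x' ξ => ((huK t ht).1 x x' ξ).trans
      (mul_le_mul_of_nonneg_right (by dsimp only [Q]; linarith) (by positivity))
    U_holder_snd := fun x ξ ξ' => ((huK t ht).2 x ξ ξ').trans
      (mul_le_mul_of_nonneg_right (by dsimp only [Q]; linarith) (by positivity))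
    E_holder := fun x x' => (hEL t ht x x').trans
      (mul_le_mul_of_nonneg_right (by dsimp only [Q]; linarith) (by positivity))
    B_holder := fun x x' => (hBL t ht x x').trans
      (mul_le_mul_of_nonneg_right (by dsimp only [Q]; linarith) (by positivity))
    G_lipschitz := fun z z' => by
      have h := Convex.norm_image_sub_le_of_norm_fderiv_le (𝕜 := ℝ) (f := Ψ) (s := univ)
        (C := C) (fun p _ => hΨ.differentiable p) (fun p _ => hΨC' p) convex_univ
        (mem_univ (t, z')) (mem_univ (t, z))
      have e : ‖((t, z) : Phase) - (t, z')‖ = ‖z - z'‖ := by simp [Prod.norm_def]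
      rw [e] at h
      exact h.trans (mul_le_mul_of_nonneg_right hCQ (norm_nonneg _))
    G_supp := fun z hz => hΨR _ (hR t z hz)
    W_supp := fun z hz => by simp [hΨR' _ (hR t z hz)] }

theorem WeakSol.sq {T α β : ℝ} (hT : 0 < T) (hα : 0 < α) (hα1 : α < 1) (hβ : 0 < β)
    (hO : α * β + β + 3 * α - 1 > 0) {u : Phase → ℝ} {E B : ℝ → E3 → E3}
    (hE : HolderField T β E) (hB : HolderField T β B) (hu : HolderBdd T α u)
    (hw : WeakSol T (vlasovField E B) u) :
    WeakSol T (vlasovField E B) fun p => u p * u p := by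
  intro Ψ hΨ
  have hA := measBdd_vlasovField hE.toMeasBdd hB.toMeasBdd
  obtain ⟨Q, R, hQ, hR, hΨQ, hDQ, huQ, hAQ, hslice⟩ := exists_isSlice hu hE hB hΨ
  obtain ⟨A, hA0, hker⟩ := exists_isKernel
  have hum := hu.measurable
  have hAm := hA.measurable
  have hΨm := hΨ.smooth.continuous.measurable
  have hΨm' := hΨ.continuous_fderiv.measurable
  have hint : Integrable fun p => u p * u p * fderiv ℝ Ψ p (1, vlasovField E B p) := by
    refine hΨ.integrable (g := fun p => u p * u p) ⟨by fun_prop, Q * Q, fun p => ?_⟩ hA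
    rw [Real.norm_eq_abs, abs_mul]
    exact mul_le_mul (huQ p) (huQ p) (abs_nonneg _) hQ
  have e0 : ∫ p, u p * u p * fderiv ℝ Ψ p (1, vlasovField E B p)
      = ∫ t : ℝ, ∫ z : E3 × E3,
        u (t, z) * (u (t, z) * fderiv ℝ Ψ (t, z) (1, vlasovField E B (t, z))) := by
    refine (integral_prod _ hint).trans ?_
    simp only [mul_assoc]
  have hint' : Integrable fun t : ℝ => ∫ z : E3 × E3,
        u (t, z) * (u (t, z) * fderiv ℝ Ψ (t, z) (1, vlasovField E B (t, z))) := by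
    have := Integrable.integral_prod_left hint
    simpa only [mul_assoc] using this
  set v := volume.real (Metric.closedBall (0 : E3) R)
  set v₁ := volume.real (Metric.closedBall (0 : E3) (R + 1))
  set v₂ := volume.real (Metric.closedBall (0 : E3 × E3) R)
  rw [← abs_eq_zero]
  refine le_antisymm (le_of_forall_pos_lt_add fun η hη => ?_) (abs_nonneg _)
  obtain ⟨ε, δ, hε, hε1, hδ, hδ1, herr⟩ := exists_scales hα hα1 hβ hO
    (Q * (Q * Q) * v₂) (Q * (Q * Q) * v₂ + Q * (Q * Q) * (2 * Q) * A * v * v)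
    (Q ^ 2 * (Q * 2) * A * v₁ * v) (Q ^ 2 * (4 * Q ^ 2) * A * v₁ * v)
    (Q * Q * (Q * 2) * A * v₁ * v) (Q * Q * (4 * Q ^ 2) * A * v₁ * v) (div_pos hη hT)
  obtain ⟨k₁, hk₁⟩ := hker ε hε
  obtain ⟨k₂, hk₂⟩ := hker δ hδ
  let k : E3 × E3 → ℝ := fun q => k₁ q.1 * k₂ q.2
  have hk : ContDiff ℝ (⊤ : ℕ∞) k :=
    (hk₁.smooth.comp contDiff_fst).mul (hk₂.smooth.comp contDiff_snd)
  have hks : ∀ q, max ε δ < ‖q‖ → k q = 0 := fun q hq => by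
    rcases lt_max_iff.1 (show max ε δ < max ‖q.1‖ ‖q.2‖ from hq) with h | h
    · simp [k, hk₁.supp _ ((le_max_left _ _).trans_lt h)]
    · simp [k, hk₂.supp _ ((le_max_right _ _).trans_lt h)]
  have hks' : ∀ q, max ε δ < ‖q‖ → fderiv ℝ k q = 0 := fun q hq => fderiv_eq_zero_of_lt_norm hks hq
  have hkc : Continuous (fderiv ℝ k) := hk.continuous_fderiv (by simp)
  obtain ⟨C₁, hC₁, hkC₁⟩ := exists_bound_of_lt_norm hk.continuous hks
  obtain ⟨C₂, hC₂, hkC₂⟩ := exists_bound_of_lt_norm hkc hks'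
  have hkm := hk.continuous.measurable
  have hkm' := hkc.measurable
  let F : ℝ × (E3 × E3) × E3 × E3 → ℝ := fun p => u (p.1, p.2.1) * u (p.1, p.2.2) *
    (fderiv ℝ Ψ (p.1, p.2.2) (1, vlasovField E B (p.1, p.2.2)) * k (p.2.1 - p.2.2)
    + Ψ (p.1, p.2.2) * fderiv ℝ k (p.2.1 - p.2.2)
      (vlasovField E B (p.1, p.2.1) - vlasovField E B (p.1, p.2.2)))
  have hF0 : ∫ p, F p = 0 := hw.integral_doubling_space hu.toMeasBdd hA hΨ hk hks
  have hFi : Integrable F := by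
    have hF : Measurable F := by dsimp only [F]; fun_prop
    refine integrable_of_bounded_of_support hF
      (C := Q * Q * (Q * (1 + Q) * C₁ + Q * (C₂ * (Q + Q)))) (R := R + max ε δ)
      (fun p => ?_) (fun p hp => ?_)
    · have h1 := huQ (p.1, p.2.1)
      have h2 := huQ (p.1, p.2.2)
      have h3 : ‖fderiv ℝ Ψ (p.1, p.2.2) (1, vlasovField E B (p.1, p.2.2))‖ ≤ Q * (1 + Q) := by
        refine ((fderiv ℝ Ψ (p.1, p.2.2)).le_opNorm _).trans
          (mul_le_mul (hDQ _) (max_le ?_ ?_) (norm_nonneg _) hQ)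
        · simp only [norm_one]
          linarith
        · exact (hAQ _).trans (by linarith)
      have h4 := hkC₁ (p.2.1 - p.2.2)
      have h5 := hΨQ (p.1, p.2.2)
      have h6 := ((fderiv ℝ k (p.2.1 - p.2.2)).le_opNorm
        (vlasovField E B (p.1, p.2.1) - vlasovField E B (p.1, p.2.2))).trans
        (mul_le_mul (hkC₂ _) ((norm_sub_le _ _).trans (add_le_add (hAQ _) (hAQ _)))
          (norm_nonneg _) hC₂)
      rw [Real.norm_eq_abs] at h3 h4 h6
      dsimp only [F]
      rw [abs_mul, abs_mul]
      refine mul_le_mul (mul_le_mul h1 h2 (abs_nonneg _) hQ) ((abs_add_le _ _).trans ?_)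
        (abs_nonneg _) (by positivity)
      exact add_le_add
        ((abs_mul _ _).trans_le (mul_le_mul h3 h4 (abs_nonneg _) (by positivity)))
        ((abs_mul _ _).trans_le (mul_le_mul h5 h6 (abs_nonneg _) hQ))
    · by_cases h1 : R < ‖((p.1, p.2.2) : Phase)‖
      · simp [F, (hR _ h1).1, (hR _ h1).2]
      · have h2 : max ε δ < ‖p.2.1 - p.2.2‖ := by
          by_contra! h2
          push Not at h1
          have h3 : ‖p.1‖ ≤ R := (le_max_left _ _).trans h1
          have h4 : ‖p.2.2‖ ≤ R := (le_max_right _ _).trans h1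
          have h5 : 0 < max ε δ := lt_max_of_lt_left hε
          have h6 : ‖p‖ ≤ R + max ε δ := max_le (by linarith)
            (max_le (by linarith [norm_le_norm_add_norm_sub p.2.2 p.2.1,
              norm_sub_rev p.2.2 p.2.1]) (by linarith))
          linarith
        simp [F, hks _ h2, hks' _ h2]
  have hF0' : ∫ t : ℝ, ∫ z : (E3 × E3) × E3 × E3, F (t, z) = 0 :=
    (integral_prod _ hFi).symm.trans hF0
  have hFi' : Integrable fun t : ℝ => ∫ z : (E3 × E3) × E3 × E3, F (t, z) :=
    Integrable.integral_prod_left hFi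
  have hsub := integral_sub hFi' hint'
  rw [hF0', zero_sub] at hsub
  rw [e0, ← abs_neg, ← hsub, zero_add]
  refine lt_of_le_of_lt (b := η / T * T - (η / T - (Q * (Q * Q) * v₂ * ε ^ α
    + (Q * (Q * Q) * v₂ + Q * (Q * Q) * (2 * Q) * A * v * v) * δ ^ α
    + Q ^ 2 * (Q * 2) * A * v₁ * v * δ + Q ^ 2 * (4 * Q ^ 2) * A * v₁ * v * ε ^ β
    + Q * Q * (Q * 2) * A * v₁ * v * (ε ^ α * δ ^ α * δ / ε)
    + Q * Q * (4 * Q ^ 2) * A * v₁ * v * (δ ^ α * ε ^ α * ε ^ β / δ))) * T) ?_ ?_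
  swap
  · rw [div_mul_cancel₀ _ hT.ne']
    have := mul_pos (sub_pos.2 herr) hT
    linarith
  set err := Q * (Q * Q) * v₂ * ε ^ α
    + (Q * (Q * Q) * v₂ + Q * (Q * Q) * (2 * Q) * A * v * v) * δ ^ α
    + Q ^ 2 * (Q * 2) * A * v₁ * v * δ + Q ^ 2 * (4 * Q ^ 2) * A * v₁ * v * ε ^ β
    + Q * Q * (Q * 2) * A * v₁ * v * (ε ^ α * δ ^ α * δ / ε)
    + Q * Q * (4 * Q ^ 2) * A * v₁ * v * (δ ^ α * ε ^ α * ε ^ β / δ) with herr_def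
  have e1 : ∫ t : ℝ, (Ioo 0 T).indicator (fun _ => err) t = err * T := by
    rw [integral_indicator measurableSet_Ioo, setIntegral_const, smul_eq_mul,
      Real.volume_real_Ioo_of_le hT.le, sub_zero, mul_comm]
  rw [← sub_mul, sub_sub_cancel, ← e1, ← Real.norm_eq_abs]
  refine norm_integral_le_of_norm_le ((integrable_indicator_iff measurableSet_Ioo).2
    (integrableOn_const measure_Ioo_lt_top.ne)) (Filter.Eventually.of_forall fun t => ?_)
  by_cases ht : t ∈ Ioo 0 T
  · rw [indicator_of_mem ht, Real.norm_eq_abs]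
    refine ((hslice t ht).abs_doubling_sub_le hk₁ hk₂ hA0 hα.le hβ.le hε.le hε1 hδ.le
      hδ1).trans_eq ?_
    rw [herr_def]
    field_simp
    ring
  · rw [indicator_of_notMem ht]
    simp [F, hΨ.eq_zero (p := (t, _)) ht, hΨ.fderiv_eq_zero (p := (t, _)) ht]

theorem weakSol_one {T : ℝ} {E B : ℝ → E3 → E3}
    (hE : MeasBdd fun p : ℝ × E3 => E p.1 p.2) (hB : MeasBdd fun p : ℝ × E3 => B p.1 p.2) :
    WeakSol T (vlasovField E B) fun _ => 1 := by
  intro Ψ hΨ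
  have hΨ1 : ContDiff ℝ 1 Ψ := hΨ.smooth.of_le (by exact_mod_cast le_top)
  have hA := measBdd_vlasovField hE hB
  have hi := hΨ.integrable (g := fun _ => (1 : ℝ)) ⟨measurable_const, 1, by simp⟩ hA
  obtain ⟨C, R, -, -, -, -, hR, -⟩ := hΨ.exists_bound
  have i1 : Integrable fun p : Phase => fderiv ℝ Ψ p (1, 0, 0) := by
    simpa using integrable_mul_fderiv (μ := volume) (c := fun _ : Phase => (1 : ℝ))
      continuous_const hΨ1 hΨ.compact (1, 0, 0)
  have z1 : ∫ p : Phase, fderiv ℝ Ψ p (1, 0, 0) = 0 := by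
    simpa using integral_mul_fderiv_eq_neg (μ := volume) (c := fun _ : Phase => (1 : ℝ))
      contDiff_const hΨ1 hΨ.compact (1, 0, 0)
  let e : Fin 3 → Phase := fun i => (0, EuclideanSpace.single i 1, 0)
  have hc : ∀ i, ContDiff ℝ 1 fun p : Phase => relV p.2.2 i := fun i =>
    (contDiff_relV_apply i).comp (contDiff_snd.comp contDiff_snd)
  have hv : ∀ p : Phase, fderiv ℝ Ψ p (0, relV p.2.2, 0) = ∑ i, relV p.2.2 i * fderiv ℝ Ψ p (e i) :=
    fun p => by
      have h : ((0, relV p.2.2, 0) : Phase) = ∑ i, relV p.2.2 i • e i := by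
        have h' := (EuclideanSpace.basisFun (Fin 3) ℝ).sum_repr (relV p.2.2)
        refine Prod.ext ?_ (Prod.ext ?_ ?_)
        · simp [e, Prod.fst_sum]
        · simpa [e, Prod.fst_sum, Prod.snd_sum] using h'.symm
        · simp [e, Prod.snd_sum]
      rw [h, map_sum]
      simp
  have i2' : ∀ i, Integrable fun p : Phase => relV p.2.2 i * fderiv ℝ Ψ p (e i) := fun i =>
    integrable_mul_fderiv (hc i).continuous hΨ1 hΨ.compact _
  have i2 : Integrable fun p : Phase => fderiv ℝ Ψ p (0, relV p.2.2, 0) := by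
    simp only [hv]
    exact integrable_finsetSum _ fun i _ => i2' i
  have z2 : ∫ p : Phase, fderiv ℝ Ψ p (0, relV p.2.2, 0) = 0 := by
    simp only [hv]
    rw [integral_finsetSum _ fun i _ => i2' i]
    refine Finset.sum_eq_zero fun i _ => ?_
    rw [integral_mul_fderiv_eq_neg (hc i) hΨ1 hΨ.compact, neg_eq_zero]
    refine integral_eq_zero_of_ae (Filter.Eventually.of_forall fun p => ?_)
    have hs := ((ContinuousLinearMap.snd ℝ E3 E3).comp
      (ContinuousLinearMap.snd ℝ ℝ (E3 × E3))).hasFDerivAt (x := p)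
    have h := HasFDerivAt.comp (g := fun ξ : E3 => relV ξ i) p
      ((contDiff_relV_apply i).differentiable (by simp) _).hasFDerivAt hs
    change fderiv ℝ (fun p : Phase => relV p.2.2 i) p (e i) * Ψ p = 0
    rw [show fderiv ℝ (fun p : Phase => relV p.2.2 i) p = _ from h.fderiv]
    simp [e]
  have hsplit : ∀ p : Phase, (1 : ℝ) * fderiv ℝ Ψ p (1, vlasovField E B p)
      = fderiv ℝ Ψ p (1, 0, 0) + fderiv ℝ Ψ p (0, relV p.2.2, 0)
        + fderiv ℝ Ψ p (0, 0, (vlasovField E B p).2) := fun p => by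
    rw [one_mul, ← map_add, ← map_add]
    simp [vlasovField]
  simp only [hsplit] at hi ⊢
  have i3 : Integrable fun p : Phase => fderiv ℝ Ψ p (0, 0, (vlasovField E B p).2) := by
    refine (hi.sub (i1.add i2)).congr (Filter.Eventually.of_forall fun p => ?_)
    simp
  have i12 : Integrable fun p : Phase => fderiv ℝ Ψ p (1, 0, 0)
    + fderiv ℝ Ψ p (0, relV p.2.2, 0) := i1.add i2
  rw [integral_add i12 i3, integral_add i1 i2, z1, z2, add_zero, zero_add]
  refine (integral_prod _ i3).trans (integral_eq_zero_of_ae ?_)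
  filter_upwards [i3.prod_right_ae] with t ht
  refine (integral_prod _ ht).trans
    (integral_eq_zero_of_ae (Filter.Eventually.of_forall fun x => ?_))
  have hφ : ContDiff ℝ 1 fun η => Ψ (t, x, η) :=
    hΨ1.comp (contDiff_const.prodMk (contDiff_const.prodMk contDiff_id))
  have hφc : HasCompactSupport fun η => Ψ (t, x, η) := hasCompactSupport_of_lt_norm (r := R)
    fun η hη => hR _ (hη.trans_le ((le_max_right ‖x‖ ‖η‖).trans (le_max_right ‖t‖ ‖(x, η)‖)))
  have hd : ∀ ξ w, fderiv ℝ Ψ (t, x, ξ) (0, 0, w) = fderiv ℝ (fun η => Ψ (t, x, η)) ξ w :=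
    fun ξ w => by
      have h1 := fderiv_eq_partial_sum hΨ.differentiable t x ξ 0 w
      have h2 := fderiv_eq_partial_sum hΨ.differentiable t x ξ 0 0
      have h3 : ((1, 0, w) : Phase) = (1, 0, 0) + (0, 0, w) := by simp
      rw [h3, map_add, ← h2] at h1
      simp only [map_zero, add_zero] at h1
      linarith
  simp only [hd, vlasovField, map_add, Pi.zero_apply]
  have hcr : Continuous fun ξ => cross3 (relV ξ) (B t x) :=
    continuous_cross3.comp (continuous_relV.prodMk continuous_const)
  have j : ∀ V : E3 → E3, Continuous V →
      Integrable fun ξ => fderiv ℝ (fun η => Ψ (t, x, η)) ξ (V ξ) := fun V hV => by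
    refine Continuous.integrable_of_hasCompactSupport
      ((hφ.continuous_fderiv (by simp)).clm_apply hV) ?_
    refine (hφc.fderiv ℝ).mono fun a ha h => ha ?_
    simp [h]
  rw [integral_add (j _ continuous_const) (j _ hcr), integral_fderiv_cross3_relV hφ hφc, add_zero]
  simpa using integral_mul_fderiv_eq_neg (μ := volume) (c := fun _ : E3 => (1 : ℝ))
    contDiff_const hφ hφc (E t x)

theorem WeakSol.add {T : ℝ} {A : Phase → E3 × E3} {u v : Phase → ℝ} (hA : MeasBdd A)
    (hu : MeasBdd u) (hv : MeasBdd v) (hwu : WeakSol T A u) (hwv : WeakSol T A v) :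
    WeakSol T A fun p => u p + v p := fun Ψ hΨ => by
  simp only [add_mul]
  rw [integral_add (hΨ.integrable hu hA) (hΨ.integrable hv hA), hwu Ψ hΨ, hwv Ψ hΨ, add_zero]

theorem WeakSol.const_mul {T : ℝ} {A : Phase → E3 × E3} {u : Phase → ℝ} (c : ℝ)
    (hwu : WeakSol T A u) : WeakSol T A fun p => c * u p := fun Ψ hΨ => by
  simp only [mul_assoc]
  rw [integral_const_mul, hwu Ψ hΨ, mul_zero]

namespace HolderBdd

variable {T α : ℝ} {u v : Phase → ℝ}

theorem add (hu : HolderBdd T α u) (hv : HolderBdd T α v) :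
    HolderBdd T α fun p => u p + v p := by
  obtain ⟨M, hM⟩ := hu.bounded
  obtain ⟨N, hN⟩ := hv.bounded
  obtain ⟨K, hK, huK⟩ := hu.holder
  obtain ⟨L, hL, hvL⟩ := hv.holder
  refine ⟨⟨hu.measurable.add hv.measurable, M + N, fun p =>
    (norm_add_le _ _).trans (add_le_add (hM p) (hN p))⟩, K + L, by positivity, fun t ht =>
    ⟨fun x x' ξ => ?_, fun x ξ ξ' => ?_⟩⟩
  · rw [add_sub_add_comm, add_mul]
    exact (abs_add_le _ _).trans (add_le_add ((huK t ht).1 x x' ξ) ((hvL t ht).1 x x' ξ))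
  · rw [add_sub_add_comm, add_mul]
    exact (abs_add_le _ _).trans (add_le_add ((huK t ht).2 x ξ ξ') ((hvL t ht).2 x ξ ξ'))

theorem mul (hu : HolderBdd T α u) (hv : HolderBdd T α v) :
    HolderBdd T α fun p => u p * v p := by
  obtain ⟨M, hM, huM⟩ := hu.exists_nonneg_bound
  obtain ⟨N, hN, hvN⟩ := hv.exists_nonneg_bound
  obtain ⟨K, hK, huK⟩ := hu.holder
  obtain ⟨L, hL, hvL⟩ := hv.holder
  have key : ∀ {p q : Phase} {d : ℝ}, |u p - u q| ≤ K * d → |v p - v q| ≤ L * d →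
      |u p * v p - u q * v q| ≤ (M * L + K * N) * d := fun {p q d} h1 h2 => by
    have e : u p * v p - u q * v q = u p * (v p - v q) + (u p - u q) * v q := by ring
    rw [e]
    refine (abs_add_le _ _).trans ?_
    rw [abs_mul, abs_mul]
    have h3 := mul_le_mul (huM p) h2 (abs_nonneg _) hM
    have h4 := mul_le_mul h1 (hvN q) (norm_nonneg _) ((abs_nonneg _).trans h1)
    rw [Real.norm_eq_abs] at h3 h4
    linarith
  refine ⟨⟨hu.measurable.mul hv.measurable, M * N, fun p => ?_⟩, M * L + K * N, by positivity,
    fun t ht => ⟨fun x x' ξ => key ((huK t ht).1 x x' ξ) ((hvL t ht).1 x x' ξ),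
      fun x ξ ξ' => key ((huK t ht).2 x ξ ξ') ((hvL t ht).2 x ξ ξ')⟩⟩
  rw [norm_mul]
  exact mul_le_mul (huM p) (hvN p) (norm_nonneg _) hM

theorem const (c : ℝ) : HolderBdd T α fun _ => c :=
  ⟨⟨measurable_const, |c|, fun _ => le_rfl⟩, 0, le_rfl, fun t _ => by simp⟩

end HolderBdd

section

variable {T α β : ℝ} {E B : ℝ → E3 → E3}

theorem WeakSol.mul (hT : 0 < T) (hα : 0 < α) (hα1 : α < 1) (hβ : 0 < β)
    (hO : α * β + β + 3 * α - 1 > 0) (hE : HolderField T β E) (hB : HolderField T β B)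
    {u v : Phase → ℝ} (hu : HolderBdd T α u) (hv : HolderBdd T α v)
    (hwu : WeakSol T (vlasovField E B) u) (hwv : WeakSol T (vlasovField E B) v) :
    WeakSol T (vlasovField E B) fun p => u p * v p := by
  have hA := measBdd_vlasovField hE.toMeasBdd hB.toMeasBdd
  have h1 := WeakSol.sq hT hα hα1 hβ hO hE hB (hu.add hv)
    (WeakSol.add hA hu.toMeasBdd hv.toMeasBdd hwu hwv)
  have h2 := WeakSol.sq hT hα hα1 hβ hO hE hB hu hwu
  have h3 := WeakSol.sq hT hα hα1 hβ hO hE hB hv hwv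
  have h4 := WeakSol.add hA (hu.mul hu).toMeasBdd (hv.mul hv).toMeasBdd h2 h3
  have h5 := (WeakSol.add hA ((hu.add hv).mul (hu.add hv)).toMeasBdd
    ((HolderBdd.const (-1)).mul ((hu.mul hu).add (hv.mul hv))).toMeasBdd h1
    (h4.const_mul (-1))).const_mul 2⁻¹
  convert h5 using 2 with p
  ring

theorem WeakSol.polynomial_eval (hT : 0 < T) (hα : 0 < α) (hα1 : α < 1) (hβ : 0 < β)
    (hO : α * β + β + 3 * α - 1 > 0) (hE : HolderField T β E) (hB : HolderField T β B)
    {u : Phase → ℝ} (hu : HolderBdd T α u) (hwu : WeakSol T (vlasovField E B) u)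
    (P : Polynomial ℝ) :
    HolderBdd T α (fun p => P.eval (u p)) ∧
      WeakSol T (vlasovField E B) fun p => P.eval (u p) := by
  have hA := measBdd_vlasovField hE.toMeasBdd hB.toMeasBdd
  induction P using Polynomial.induction_on with
  | C a =>
    simp only [Polynomial.eval_C]
    exact ⟨HolderBdd.const a, by
      simpa using (weakSol_one (T := T) hE.toMeasBdd hB.toMeasBdd).const_mul a⟩
  | add P Q hP hQ =>
    simp only [Polynomial.eval_add]
    exact ⟨hP.1.add hQ.1, WeakSol.add hA hP.1.toMeasBdd hQ.1.toMeasBdd hP.2 hQ.2⟩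
  | monomial n a h =>
    simp only [pow_succ, ← mul_assoc, Polynomial.eval_mul_X (p := _ * _)]
    exact ⟨h.1.mul hu, WeakSol.mul hT hα hα1 hβ hO hE hB h.1 hu h.2 hwu⟩

theorem MeasBdd.comp_continuous {u : Phase → ℝ} (hu : MeasBdd u) {H : ℝ → ℝ}
    (hH : Continuous H) : MeasBdd fun p => H (u p) := by
  obtain ⟨M, hM⟩ := hu.bounded
  obtain ⟨C, hC⟩ := (isCompact_Icc (a := -M) (b := M)).exists_bound_of_continuousOn
    hH.continuousOn
  exact ⟨hH.measurable.comp hu.measurable, C, fun p => hC _ (abs_le.1 (hM p))⟩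

theorem WeakSol.comp_continuous (hT : 0 < T) (hα : 0 < α) (hα1 : α < 1) (hβ : 0 < β)
    (hO : α * β + β + 3 * α - 1 > 0) (hE : HolderField T β E) (hB : HolderField T β B)
    {u : Phase → ℝ} (hu : HolderBdd T α u) (hwu : WeakSol T (vlasovField E B) u) {H : ℝ → ℝ}
    (hH : Continuous H) : WeakSol T (vlasovField E B) fun p => H (u p) := by
  intro Ψ hΨ
  have hA := measBdd_vlasovField hE.toMeasBdd hB.toMeasBdd
  have i0 := hΨ.integrable (g := fun _ => (1 : ℝ)) ⟨measurable_const, 1, by simp⟩ hA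
  simp only [one_mul] at i0
  obtain ⟨M, hM⟩ := hu.bounded
  set I := ∫ p, ‖fderiv ℝ Ψ p (1, vlasovField E B p)‖
  have hI : 0 ≤ I := integral_nonneg fun _ => norm_nonneg _
  rw [← norm_eq_zero]
  refine le_antisymm (le_of_forall_pos_le_add fun η hη => ?_) (norm_nonneg _)
  obtain ⟨P, hP⟩ := exists_polynomial_near_of_continuousOn (-M) M H hH.continuousOn
    (η / (I + 1)) (by positivity)
  obtain ⟨hPu, hPw⟩ := WeakSol.polynomial_eval hT hα hα1 hβ hO hE hB hu hwu P
  have e := integral_sub (hΨ.integrable (hu.comp_continuous hH) hA)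
    (hΨ.integrable hPu.toMeasBdd hA)
  rw [hPw Ψ hΨ, sub_zero] at e
  rw [← e, zero_add]
  refine (norm_integral_le_of_norm_le (i0.norm.const_mul (η / (I + 1)))
    (Filter.Eventually.of_forall fun p => ?_)).trans ?_
  · rw [← sub_mul, norm_mul, norm_sub_rev]
    exact mul_le_mul_of_nonneg_right (hP _ (abs_le.1 (hM p))).le (norm_nonneg _)
  · rw [integral_const_mul, div_mul_eq_mul_div, div_le_iff₀ (by positivity)]
    exact mul_le_mul_of_nonneg_left (by simp [I]) hη.le

end

/-- Renormalization property (Hölder case of the main theorem): under the Onsager-type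
condition `αβ + β + 3α − 1 > 0`, if a bounded, uniformly-in-time `α`-Hölder `f` is a weak
solution of the relativistic Vlasov equation with bounded, uniformly-in-time `β`-Hölder
fields `E, B`, then `H ∘ f` is also a weak solution for every `C¹` function `H`. -/
theorem vlasov_renormalization_holder (T : ℝ) (hT : 0 < T)
    (α β : ℝ) (hα : 0 < α) (hα1 : α < 1) (hβ : 0 < β) (hβ1 : β < 1)
    (hOnsager : α * β + β + 3 * α - 1 > 0)
    (f : ℝ → EuclideanSpace ℝ (Fin 3) → EuclideanSpace ℝ (Fin 3) → ℝ)
    (E B : ℝ → EuclideanSpace ℝ (Fin 3) → EuclideanSpace ℝ (Fin 3))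
    (hf_meas : Measurable (fun p : ℝ × EuclideanSpace ℝ (Fin 3) × EuclideanSpace ℝ (Fin 3) =>
      f p.1 p.2.1 p.2.2))
    (hf_bdd : ∃ M, ∀ t x ξ, |f t x ξ| ≤ M)
    (K : ℝ) (hK : 0 ≤ K)
    (hf_hold : ∀ t ∈ Ioo (0 : ℝ) T, ∀ x ξ x' ξ',
      |f t x ξ - f t x' ξ'| ≤ K * Real.sqrt (‖x - x'‖ ^ 2 + ‖ξ - ξ'‖ ^ 2) ^ α)
    (hE_meas : Measurable (fun p : ℝ × EuclideanSpace ℝ (Fin 3) => E p.1 p.2))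
    (hB_meas : Measurable (fun p : ℝ × EuclideanSpace ℝ (Fin 3) => B p.1 p.2))
    (hEB_bdd : ∃ M, ∀ t x, ‖E t x‖ ≤ M ∧ ‖B t x‖ ≤ M)
    (L : ℝ) (hL : 0 ≤ L)
    (hE_hold : ∀ t ∈ Ioo (0 : ℝ) T, ∀ x x', ‖E t x - E t x'‖ ≤ L * ‖x - x'‖ ^ β)
    (hB_hold : ∀ t ∈ Ioo (0 : ℝ) T, ∀ x x', ‖B t x - B t x'‖ ≤ L * ‖x - x'‖ ^ β)
    (hweak : weakVlasov T E B f) :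
    ∀ H : ℝ → ℝ, ContDiff ℝ 1 H →
      weakVlasov T E B (fun t x ξ => H (f t x ξ)) := by
  obtain ⟨M, hM⟩ := hf_bdd
  obtain ⟨N, hN⟩ := hEB_bdd
  have hE : HolderField T β E := ⟨⟨hE_meas, N, fun p => (hN p.1 p.2).1⟩, L, hL, hE_hold⟩
  have hB : HolderField T β B := ⟨⟨hB_meas, N, fun p => (hN p.1 p.2).2⟩, L, hL, hB_hold⟩
  have hu : HolderBdd T α fun p : Phase => f p.1 p.2.1 p.2.2 := by
    refine ⟨⟨hf_meas, M, fun p => hM p.1 p.2.1 p.2.2⟩, K, hK, fun t ht => ⟨?_, ?_⟩⟩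
    · intro x x' ξ
      simpa [Real.sqrt_sq] using hf_hold t ht x ξ x' ξ
    · intro x ξ ξ'
      simpa [Real.sqrt_sq] using hf_hold t ht x ξ x ξ'
  have hw := (weakVlasov_iff hE.toMeasBdd hB.toMeasBdd hu.toMeasBdd).1 hweak
  intro H hH
  exact (weakVlasov_iff hE.toMeasBdd hB.toMeasBdd
    (hu.toMeasBdd.comp_continuous hH.continuous)).2
    (WeakSol.comp_continuous hT hα hα1 hβ hOnsager hE hB hu hw hH.continuous)

end
end

section
/- (Balancing of the commutator scales.) Let α, β ∈ (0,1) satisfy αβ + β + 3α − 1 > 0. For ε ∈ (0,1) define δ(ε) = (1 + √(1 + 4 ε^{2α+β−1})) / (2 ε^{α−1}). Then: (i) δ(ε) > 0 and ε^{α−1} δ(ε)² − δ(ε) − ε^{α+β} = 0, i.e. δ(ε) is the positive root of the balancing equation; and (ii) each of the three quantities ε^{α−1} δ(ε)^{α+1}, ε^{α+β} δ(ε)^{α−1}, and δ(ε)^{α} tends to 0 as ε → 0⁺. -/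
open Set Filter

noncomputable section

theorem tendsto_rpow_nhdsGT_zero_s18 {p : ℝ} (hp : 0 < p) :
    Tendsto (fun x : ℝ => x ^ p) (nhdsWithin 0 (Ioi 0)) (nhds 0) := by
  have h := (Real.continuousAt_rpow_const 0 p (Or.inr hp.le)).tendsto
  rw [Real.zero_rpow hp.ne'] at h
  exact h.mono_left nhdsWithin_le_nhds

/-- The positive root of `ε^{α−1}δ² − δ − ε^{α+β} = 0`. -/
def balancedScale (α β ε : ℝ) : ℝ :=
  (1 + Real.sqrt (1 + 4 * ε ^ (2 * α + β - 1))) / (2 * ε ^ (α - 1))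

theorem balancedScale_pos (α β : ℝ) {ε : ℝ} (hε : 0 < ε) : 0 < balancedScale α β ε := by
  unfold balancedScale
  positivity

theorem balancedScale_root (α β : ℝ) {ε : ℝ} (hε : 0 < ε) :
    ε ^ (α - 1) * balancedScale α β ε ^ 2 - balancedScale α β ε - ε ^ (α + β) = 0 := by
  have hprod : ε ^ (2 * α + β - 1) = ε ^ (α - 1) * ε ^ (α + β) := by
    rw [← Real.rpow_add hε]
    ring_nf
  have ha : 0 < ε ^ (α - 1) := by positivity
  have hc : 0 < ε ^ (α + β) := by positivity
  unfold balancedScale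
  rw [hprod]
  generalize ε ^ (α - 1) = a at *
  generalize ε ^ (α + β) = c at *
  have hs := Real.sq_sqrt (show 0 ≤ 1 + 4 * (a * c) by positivity)
  generalize √(1 + 4 * (a * c)) = s at *
  field_simp
  linear_combination hs

theorem balancedScale_le (α β : ℝ) {ε : ℝ} (hε : 0 < ε) :
    balancedScale α β ε ≤ ε ^ (1 - α) + ε ^ ((β + 1) / 2) := by
  have ha : 0 < ε ^ (α - 1) := by positivity
  have hu : 0 < ε ^ ((2 * α + β - 1) / 2) := by positivity
  have hsq : ε ^ (2 * α + β - 1) = (ε ^ ((2 * α + β - 1) / 2)) ^ 2 := by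
    rw [← Real.rpow_mul_natCast hε.le]
    norm_num
  have h1 : ε ^ (1 - α) * ε ^ (α - 1) = 1 := by
    rw [← Real.rpow_add hε]
    simp
  have h2 : ε ^ ((β + 1) / 2) * ε ^ (α - 1) = ε ^ ((2 * α + β - 1) / 2) := by
    rw [← Real.rpow_add hε]
    ring_nf
  have hs : √(1 + 4 * ε ^ (2 * α + β - 1)) ≤ 1 + 2 * ε ^ ((2 * α + β - 1) / 2) := by
    rw [hsq]
    exact Real.sqrt_le_iff.mpr ⟨by positivity, by nlinarith⟩
  unfold balancedScale
  rw [div_le_iff₀ (by positivity)]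
  linarith

/-- A power weight `ε^q` times the balanced scale vanishes as soon as it kills both of the
competing scales `ε^{1−α}` and `ε^{(β+1)/2}`. -/
theorem tendsto_rpow_mul_balancedScale {α β q : ℝ} (h1 : 0 < q + (1 - α))
    (h2 : 0 < q + (β + 1) / 2) :
    Tendsto (fun ε : ℝ => ε ^ q * balancedScale α β ε) (nhdsWithin 0 (Ioi 0)) (nhds 0) := by
  have hsum := (tendsto_rpow_nhdsGT_zero_s18 h1).add (tendsto_rpow_nhdsGT_zero_s18 h2)
  rw [add_zero] at hsum
  refine squeeze_zero' ?_ ?_ hsum <;> filter_upwards [self_mem_nhdsWithin] with ε hε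
  · have := balancedScale_pos α β hε
    have := Real.rpow_pos_of_pos hε q
    positivity
  · rw [Real.rpow_add hε, Real.rpow_add hε, ← mul_add]
    exact mul_le_mul_of_nonneg_left (balancedScale_le α β hε) (Real.rpow_nonneg (le_of_lt hε) q)

theorem Filter.Tendsto.rpow_const_zero {ι : Type*} {l : Filter ι} {f : ι → ℝ} {p : ℝ}
    (hf : Tendsto f l (nhds 0)) (hp : 0 < p) : Tendsto (fun i => f i ^ p) l (nhds 0) := by
  simpa [Real.zero_rpow hp.ne'] using hf.rpow_const (p := p) (Or.inr hp.le)

/-- Balancing of the commutator scales: under the Onsager-type condition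
`αβ + β + 3α − 1 > 0`, the positive root `δ(ε)` of `ε^{α−1}δ² − δ − ε^{α+β} = 0` makes the
three commutator bounds `ε^{α−1}δ^{α+1}`, `ε^{α+β}δ^{α−1}` and `δ^α` vanish as `ε → 0⁺`. -/
theorem commutator_scale_balancing
    (α β : ℝ) (hα : 0 < α) (hα1 : α < 1) (hβ : 0 < β) (hβ1 : β < 1)
    (hOnsager : α * β + β + 3 * α - 1 > 0) :
    (∀ ε : ℝ, ε ∈ Ioo (0 : ℝ) 1 →
      0 < (1 + Real.sqrt (1 + 4 * ε ^ (2 * α + β - 1))) / (2 * ε ^ (α - 1)) ∧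
      ε ^ (α - 1) * ((1 + Real.sqrt (1 + 4 * ε ^ (2 * α + β - 1))) / (2 * ε ^ (α - 1))) ^ 2
        - (1 + Real.sqrt (1 + 4 * ε ^ (2 * α + β - 1))) / (2 * ε ^ (α - 1))
        - ε ^ (α + β) = 0) ∧
    Tendsto (fun ε : ℝ =>
        ε ^ (α - 1) * ((1 + Real.sqrt (1 + 4 * ε ^ (2 * α + β - 1))) / (2 * ε ^ (α - 1)))
          ^ (α + 1))
      (nhdsWithin 0 (Ioi 0)) (nhds 0) ∧
    Tendsto (fun ε : ℝ =>
        ε ^ (α + β) * ((1 + Real.sqrt (1 + 4 * ε ^ (2 * α + β - 1))) / (2 * ε ^ (α - 1)))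
          ^ (α - 1))
      (nhdsWithin 0 (Ioi 0)) (nhds 0) ∧
    Tendsto (fun ε : ℝ =>
        ((1 + Real.sqrt (1 + 4 * ε ^ (2 * α + β - 1))) / (2 * ε ^ (α - 1))) ^ α)
      (nhdsWithin 0 (Ioi 0)) (nhds 0) := by
  simp only [← balancedScale.eq_def]
  have hfirst : Tendsto (fun ε : ℝ => ε ^ (α - 1) * balancedScale α β ε ^ (α + 1))
      (nhdsWithin 0 (Ioi 0)) (nhds 0) := by
    have hα' : 0 < α + 1 := by linarith
    have h1 : 0 < (α - 1) / (α + 1) + (1 - α) := by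
      have : (α - 1) / (α + 1) + (1 - α) = α * (1 - α) / (α + 1) := by
        field_simp
        ring
      rw [this]
      exact div_pos (mul_pos hα (by linarith)) hα'
    have h2 : 0 < (α - 1) / (α + 1) + (β + 1) / 2 := by
      have : (α - 1) / (α + 1) + (β + 1) / 2
          = (α * β + β + 3 * α - 1) / (2 * (α + 1)) := by
        field_simp
        ring
      rw [this]
      exact div_pos hOnsager (by linarith)
    refine ((tendsto_rpow_mul_balancedScale h1 h2).rpow_const_zero hα').congr' ?_
    filter_upwards [self_mem_nhdsWithin] with ε hε
    have hε' : 0 < ε := hε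
    rw [Real.mul_rpow (by positivity) (balancedScale_pos α β hε').le, ← Real.rpow_mul hε'.le,
      div_mul_cancel₀ _ hα'.ne']
  refine ⟨fun ε hε => ⟨balancedScale_pos α β hε.1, balancedScale_root α β hε.1⟩, hfirst, ?_, ?_⟩
  · refine squeeze_zero' ?_ ?_ hfirst <;> filter_upwards [self_mem_nhdsWithin] with ε hε
    · have hε' : 0 < ε := hε
      have := balancedScale_pos α β hε'
      positivity
    · have hδ := balancedScale_pos α β hε
      have hroot := balancedScale_root α β hε
      have hpow : balancedScale α β ε ^ (α + 1)
          = balancedScale α β ε ^ 2 * balancedScale α β ε ^ (α - 1) := by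
        rw [← Real.rpow_natCast, ← Real.rpow_add hδ]
        norm_num
        ring_nf
      rw [hpow, ← mul_assoc]
      exact mul_le_mul_of_nonneg_right (by linarith) (by positivity)
  · have h := tendsto_rpow_mul_balancedScale (α := α) (β := β) (q := 0)
      (by linarith) (by linarith)
    simp only [Real.rpow_zero, one_mul] at h
    exact h.rpow_const_zero hα

end
end
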